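/- Let n ≥ 3, let s ≥ 0, and set b = 1/2, a = (1+s)/2 and p = 1 − 4/(n+2+4s). Let C(p) := {R ∈ S²_B(so(n)) : R is positive semidefinite and Ric(R) − p·(tr(Ric(R))/n)·id is positive semidefinite}. Then the set ℓ_{a,b}(C(p)) is invariant under the ordinary differential equation dR/dt = R² + R^#: for every S ∈ ℓ_{a,b}(C(p)), S² + S^# ∈ T_S(ℓ_{a,b}(C(p))); moreover, S² + S^# lies in the interior of T_S(ℓ_{a,b}(C(p))) for every nonzero S ∈ ℓ_{a,b}(C(p)). -/

import Mathlib

/-!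
Common setup: we identify ⋀²ℝⁿ with the Lie algebra `so n` of real skew-symmetric
`n × n` matrices, sending `eᵢ ∧ eⱼ` to the rotation by `π/2` in the plane spanned by
`eᵢ, eⱼ`; the inner product on `so n` is `⟪A, B⟫ = -(1/2)·tr (A * B)`, and under this
identification `v ∧ w` corresponds to the skew-symmetric matrix `v wᵀ - w vᵀ`, while
the wedge `A ∧ B` of two endomorphisms of `ℝⁿ` acts on a skew matrix `M` by
`M ↦ (1/2)(A M Bᵀ + B M Aᵀ)` (the unique linear extension of
`v∧w ↦ (1/2)(Av ∧ Bw + Bv ∧ Aw)`).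
-/

noncomputable section

namespace BW

open Matrix

abbrev Mat (n : ℕ) := Matrix (Fin n) (Fin n) ℝ

/-- `so n`: the space of real skew-symmetric `n × n` matrices (≅ ⋀²ℝⁿ). -/
def so (n : ℕ) : Submodule ℝ (Mat n) where
  carrier := {A | Aᵀ = -A}
  add_mem' := by
    intro A B hA hB
    simp only [Set.mem_setOf_eq] at *
    rw [Matrix.transpose_add, hA, hB, neg_add]
  zero_mem' := by simp
  smul_mem' := by
    intro c A hA
    simp only [Set.mem_setOf_eq] at *
    rw [Matrix.transpose_smul, hA, smul_neg]

variable {n : ℕ}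

lemma mem_so_iff {A : Mat n} : A ∈ so n ↔ Aᵀ = -A := Iff.rfl

/-- The inner product `⟨A,B⟩ = -(1/2)·tr(AB)` on `so n`. -/
def ip (A B : so n) : ℝ := -(1/2) * Matrix.trace ((A : Mat n) * (B : Mat n))

/-- `ip` as a linear map in the second variable. -/
def ipL (A : so n) : so n →ₗ[ℝ] ℝ where
  toFun B := ip A B
  map_add' B C := by
    simp only [ip, Submodule.coe_add, Matrix.mul_add, Matrix.trace_add]; ring
  map_smul' c B := by
    simp only [ip, SetLike.val_smul, Matrix.mul_smul, Matrix.trace_smul, smul_eq_mul,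
      RingHom.id_apply]; ring

/-- The Lie bracket (matrix commutator) on `so n`. -/
def brk (A B : so n) : so n :=
  ⟨(A : Mat n) * (B : Mat n) - (B : Mat n) * (A : Mat n), by
    have hA : (A : Mat n)ᵀ = -(A : Mat n) := A.2
    have hB : (B : Mat n)ᵀ = -(B : Mat n) := B.2
    rw [mem_so_iff, Matrix.transpose_sub, Matrix.transpose_mul, Matrix.transpose_mul, hA, hB]
    noncomm_ring⟩

/-- Auxiliary linear map underlying `A ∧ B`. -/
def wedgeAux (A B : Mat n) : Mat n →ₗ[ℝ] Mat n where
  toFun M := (1/2 : ℝ) • (A * M * Bᵀ + B * M * Aᵀ)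
  map_add' M N := by
    simp only [mul_add, add_mul, smul_add]
    module
  map_smul' c M := by
    simp only [mul_smul_comm, smul_mul_assoc, RingHom.id_apply]
    module

lemma wedgeAux_mem (A B : Mat n) : ∀ M ∈ so n, wedgeAux A B M ∈ so n := by
  intro M hM
  rw [mem_so_iff] at hM ⊢
  show ((1/2 : ℝ) • (A * M * Bᵀ + B * M * Aᵀ))ᵀ = -((1/2 : ℝ) • (A * M * Bᵀ + B * M * Aᵀ))
  rw [Matrix.transpose_smul, Matrix.transpose_add, Matrix.transpose_mul, Matrix.transpose_mul,
    Matrix.transpose_mul, Matrix.transpose_mul, Matrix.transpose_transpose,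
    Matrix.transpose_transpose, hM]
  simp only [Matrix.neg_mul, Matrix.mul_neg, Matrix.mul_assoc, smul_neg, neg_add, smul_add]
  abel

/-- The wedge `A ∧ B` of two endomorphisms of ℝⁿ, as an endomorphism of `so n ≅ ⋀²ℝⁿ`:
the unique linear map with `(A ∧ B)(v ∧ w) = (1/2)(Av ∧ Bw + Bv ∧ Aw)`. -/
def wedge (A B : Mat n) : Module.End ℝ (so n) :=
  (wedgeAux A B).restrict (p := so n) (q := so n) (wedgeAux_mem A B)

/-- The index set of pairs `i < j`. -/
def pairs (n : ℕ) : Finset (Fin n × Fin n) := Finset.univ.filter fun p => p.1 < p.2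

/-- The standard basis vector `eᵢ` of ℝⁿ. -/
def evec (i : Fin n) : Fin n → ℝ := fun k => if k = i then 1 else 0

/-- `v ∧ w`, as an element of `so n ≅ ⋀²ℝⁿ`. -/
def vwedge (v w : Fin n → ℝ) : so n :=
  ⟨Matrix.of fun i j => v i * w j - w i * v j, by
    rw [mem_so_iff]
    ext i j
    simp only [Matrix.transpose_apply, Matrix.of_apply, Matrix.neg_apply]
    ring⟩

/-- The orthonormal basis vector `eᵢ ∧ eⱼ` of `so n ≅ ⋀²ℝⁿ`. -/
def bvec (i j : Fin n) : so n := vwedge (evec i) (evec j)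

/-- Hamilton's sharp product `R # S`: the self-adjoint endomorphism of `so n` determined by
`⟨(R#S)h, h⟩ = (1/2)·Σ_{α,β} ⟨[R(b_α), S(b_β)], h⟩·⟨[b_α, b_β], h⟩`,
where `(b_α)` is the orthonormal basis `(eᵢ ∧ eⱼ)_{i<j}` of `so n`. -/
def sharp (R S : Module.End ℝ (so n)) : Module.End ℝ (so n) :=
  (1/4 : ℝ) • ∑ p ∈ pairs n, ∑ q ∈ pairs n,
    ((ipL (brk (R (bvec p.1 p.2)) (S (bvec q.1 q.2)))).smulRight
        (brk (bvec p.1 p.2) (bvec q.1 q.2))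
      + (ipL (brk (bvec p.1 p.2) (bvec q.1 q.2))).smulRight
        (brk (R (bvec p.1 p.2)) (S (bvec q.1 q.2))))

/-- The right-hand side `R² + R^#` of Hamilton's ODE. -/
def Qode (R : Module.End ℝ (so n)) : Module.End ℝ (so n) := R * R + sharp R R

/-- The coordinates `R_{ijkl} = ⟨R(eᵢ∧eⱼ), e_k∧e_l⟩` of an endomorphism of `so n`. -/
def Rcoord (R : Module.End ℝ (so n)) (i j k l : Fin n) : ℝ := ip (R (bvec i j)) (bvec k l)

/-- Self-adjointness with respect to the inner product `ip`. -/
def selfAdjEnd (R : Module.End ℝ (so n)) : Prop := ∀ X Y : so n, ip (R X) Y = ip X (R Y)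

/-- A curvature operator: a self-adjoint endomorphism of `so n ≅ ⋀²ℝⁿ` satisfying the
first Bianchi identity.  (`isCurvOp` carves out `S²_B(so n)`.) -/
def isCurvOp (R : Module.End ℝ (so n)) : Prop :=
  selfAdjEnd R ∧
    ∀ i j k l : Fin n, Rcoord R i j k l + Rcoord R j k i l + Rcoord R k i j l = 0

/-- The Ricci tensor `Ric_{ij} = Σ_k R_{ikjk}` of `R`. -/
def RicM (R : Module.End ℝ (so n)) : Mat n := Matrix.of fun i j => ∑ k, Rcoord R i k j k

/-- `λ̄ = tr(Ric)/n`. -/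
def lamb (R : Module.End ℝ (so n)) : ℝ := Matrix.trace (RicM R) / (n : ℝ)

/-- The traceless Ricci tensor `Ric₀ = Ric - (tr Ric / n)·id`. -/
def Ric0 (R : Module.End ℝ (so n)) : Mat n := RicM R - lamb R • (1 : Mat n)

/-- `σ = tr(Ric₀²)/n`. -/
def sigmaR (R : Module.End ℝ (so n)) : ℝ := Matrix.trace (Ric0 R * Ric0 R) / (n : ℝ)

/-- `R_I = (λ̄/(n-1))·(id ∧ id)`, the projection of `R` onto `⟨I⟩`. -/
def RI (R : Module.End ℝ (so n)) : Module.End ℝ (so n) :=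
  (lamb R / ((n : ℝ) - 1)) • wedge (1 : Mat n) (1 : Mat n)

/-- `R_{Ric₀} = (2/(n-2))·(Ric₀ ∧ id)`, the projection of `R` onto `⟨Ric₀⟩`. -/
def RRic0 (R : Module.End ℝ (so n)) : Module.End ℝ (so n) :=
  (2 / ((n : ℝ) - 2)) • wedge (Ric0 R) (1 : Mat n)

/-- The linear map `ℓ_{a,b}(R) = R + 2(n-1)a·R_I + (n-2)b·R_{Ric₀}`. -/
def lab (a b : ℝ) (R : Module.End ℝ (so n)) : Module.End ℝ (so n) :=
  R + (2 * ((n : ℝ) - 1) * a) • RI R + (((n : ℝ) - 2) * b) • RRic0 R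

/-- Positive semidefiniteness of the quadratic form of an endomorphism of `so n`. -/
def posSemidefEnd (R : Module.End ℝ (so n)) : Prop := ∀ X : so n, 0 ≤ ip (R X) X

/-- Positive definiteness of the quadratic form of an endomorphism of `so n`. -/
def posDefEnd (R : Module.End ℝ (so n)) : Prop := ∀ X : so n, X ≠ 0 → 0 < ip (R X) X

/-- `R` is 2-nonnegative: the sum of its two smallest eigenvalues is nonnegative;
equivalently (Ky Fan), `q_R(X) + q_R(Y) ≥ 0` for all orthonormal pairs `X, Y`. -/
def twoNonneg (R : Module.End ℝ (so n)) : Prop :=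
  ∀ X Y : so n, ip X X = 1 → ip Y Y = 1 → ip X Y = 0 → 0 ≤ ip (R X) X + ip (R Y) Y

/-- The (Frobenius) norm of an endomorphism of `so n`, computed in the orthonormal
basis `(eᵢ ∧ eⱼ)_{i<j}`. -/
def endNorm (R : Module.End ℝ (so n)) : ℝ :=
  Real.sqrt (∑ p ∈ pairs n, ip (R (bvec p.1 p.2)) (R (bvec p.1 p.2)))

/-- The tangent cone `T_R C`: the closure of `{t·(S - R) : S ∈ C, t ≥ 0}`. -/
def tangCone (C : Set (Module.End ℝ (so n))) (R : Module.End ℝ (so n)) :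
    Set (Module.End ℝ (so n)) :=
  {X | ∀ ε > 0, ∃ S ∈ C, ∃ t : ℝ, 0 ≤ t ∧ endNorm (X - t • (S - R)) < ε}

/-- `C` is a closed subset of the space of endomorphisms of `so n`. -/
def isClosedSet (C : Set (Module.End ℝ (so n))) : Prop :=
  ∀ X, (∀ ε > 0, ∃ Y ∈ C, endNorm (X - Y) < ε) → X ∈ C

/-- The interior of `C` relative to the subspace `S²_B(so n)` of curvature operators. -/
def interiorCurv (C : Set (Module.End ℝ (so n))) : Set (Module.End ℝ (so n)) :=
  {X | isCurvOp X ∧ ∃ ε > 0, ∀ Y, isCurvOp Y → endNorm (Y - X) < ε → Y ∈ C}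

/-- Auxiliary linear map `M ↦ g M gᵀ` on matrices. -/
def conjAux (g : Mat n) : Mat n →ₗ[ℝ] Mat n where
  toFun M := g * M * gᵀ
  map_add' M N := by simp only [mul_add, add_mul]
  map_smul' c M := by simp only [mul_smul_comm, smul_mul_assoc, RingHom.id_apply]

/-- `⋀²g` : the action `M ↦ g M gᵀ` of `g` on `so n ≅ ⋀²ℝⁿ` (for `g` orthogonal this is
the second exterior power of `g`). -/
def conjSo (g : Mat n) : Module.End ℝ (so n) :=
  (conjAux g).restrict (p := so n) (q := so n) (fun M hM => by
    rw [mem_so_iff] at hM ⊢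
    show (g * M * gᵀ)ᵀ = -(g * M * gᵀ)
    rw [Matrix.transpose_mul, Matrix.transpose_mul, Matrix.transpose_transpose, hM]
    simp only [Matrix.neg_mul, Matrix.mul_neg, Matrix.mul_assoc])

/-- The action `g · R = (⋀²g) ∘ R ∘ (⋀²g)⁻¹` of an orthogonal matrix `g`
(whose inverse is `gᵀ`) on endomorphisms of `so n`. -/
def onAct (g : Mat n) (R : Module.End ℝ (so n)) : Module.End ℝ (so n) :=
  conjSo g * R * conjSo gᵀ

/-- Two sets are at Hausdorff distance at most `ε` from each other. -/
def hdClose (A B : Set (Module.End ℝ (so n))) (ε : ℝ) : Prop :=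
  (∀ X ∈ A, ∃ Y ∈ B, endNorm (X - Y) ≤ ε) ∧ ∀ Y ∈ B, ∃ X ∈ A, endNorm (X - Y) ≤ ε

/-- The truncation `C ∩ {‖R‖ ≤ 1}`. -/
def truncSet (C : Set (Module.End ℝ (so n))) : Set (Module.End ℝ (so n)) :=
  {R ∈ C | endNorm R ≤ 1}


/-- The set `C(p)` of nonnegative curvature operators with `Ric ≥ p·(tr Ric / n)·id`. -/
def Cpinch (n : ℕ) (p : ℝ) : Set (Module.End ℝ (so n)) :=
  {R | isCurvOp R ∧ posSemidefEnd R ∧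
    (RicM R - (p * (Matrix.trace (RicM R) / (n : ℝ))) • (1 : Mat n)).PosSemidef}

lemma so_skew (A : so n) (i j : Fin n) : (A : Mat n) j i = -(A : Mat n) i j := by
  have := congrFun (congrFun A.2 i) j
  simpa using this

lemma bvec_apply (i j k l : Fin n) : (bvec i j : Mat n) k l
    = (1 : Mat n) i k * (1 : Mat n) j l - (1 : Mat n) j k * (1 : Mat n) i l := by
  simp [bvec, vwedge, evec, Matrix.one_apply, eq_comm]

lemma ip_eq (A B : so n) : ip A B = 1 / 2 * ∑ i, ∑ j, (A : Mat n) i j * (B : Mat n) i j := by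
  simp only [ip, Matrix.trace, Matrix.diag_apply, Matrix.mul_apply, Finset.mul_sum]
  refine Finset.sum_congr rfl fun i _ => Finset.sum_congr rfl fun j _ => ?_
  rw [so_skew B i j]; ring

lemma ip_self_nonneg (A : so n) : 0 ≤ ip A A := by
  rw [ip_eq]
  exact mul_nonneg (by norm_num)
    (Finset.sum_nonneg fun i _ => Finset.sum_nonneg fun j _ => mul_self_nonneg _)

lemma ip_bvec (A : so n) (k l : Fin n) : ip A (bvec k l) = (A : Mat n) k l := by
  rw [ip_eq]
  simp only [bvec_apply, mul_sub, Finset.sum_sub_distrib, Matrix.one_apply, mul_ite,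
    mul_one, mul_zero, Finset.sum_ite_eq, Finset.mem_univ, if_true]
  rw [so_skew A k l]; ring

lemma Rcoord_eq (R : Module.End ℝ (so n)) (i j k l : Fin n) :
    Rcoord R i j k l = (R (bvec i j) : Mat n) k l := ip_bvec _ _ _

lemma bvec_swap (i j : Fin n) : bvec j i = -bvec i j := by
  ext k l
  simp only [bvec_apply, Submodule.coe_neg, Matrix.neg_apply]; ring

lemma Rcoord_skew_left (R : Module.End ℝ (so n)) (i j k l : Fin n) :
    Rcoord R j i k l = -Rcoord R i j k l := by
  rw [Rcoord_eq, Rcoord_eq, bvec_swap, map_neg]; rfl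

/-- A skew matrix expands in the spanning family `eᵢ ∧ eⱼ`. -/
lemma so_expand (X : so n) : X = (1 / 2 : ℝ) • ∑ i, ∑ j, (X : Mat n) i j • bvec i j := by
  ext k l
  simp only [Submodule.coe_smul, Submodule.coe_sum, Matrix.smul_apply, Matrix.sum_apply,
    bvec_apply, smul_eq_mul, mul_sub, Finset.sum_sub_distrib, Matrix.one_apply, mul_ite,
    mul_one, mul_zero, Finset.sum_ite_eq', Finset.mem_univ,
    if_true, Finset.sum_ite_irrel, Finset.sum_const_zero]
  rw [so_skew X k l]; ring

lemma End_apply (R : Module.End ℝ (so n)) (X : so n) (k l : Fin n) :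
    (R X : Mat n) k l = 1 / 2 * ∑ i, ∑ j, (X : Mat n) i j * Rcoord R i j k l := by
  conv_lhs => rw [so_expand X]
  simp only [map_smul, map_sum, Submodule.coe_smul, Submodule.coe_sum, Matrix.smul_apply,
    Matrix.sum_apply, smul_eq_mul, Rcoord_eq]

lemma End_ext {R S : Module.End ℝ (so n)} (h : ∀ i j k l, Rcoord R i j k l = Rcoord S i j k l) :
    R = S := by
  refine LinearMap.ext fun X => ?_
  ext k l
  simp only [End_apply, h]

lemma sum_comm_pairs (f : Fin n → Fin n → Fin n → Fin n → ℝ) :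
    ∑ k, ∑ l, ∑ i, ∑ j, f i j k l = ∑ i, ∑ j, ∑ k, ∑ l, f i j k l := by
  have e (g : Fin n → Fin n → Fin n → Fin n → ℝ) : ∑ k, ∑ l, ∑ i, ∑ j, g k l i j
      = ∑ x : Fin n × Fin n, ∑ y : Fin n × Fin n, g x.1 x.2 y.1 y.2 := by
    simp only [Fintype.sum_prod_type]
  rw [e fun k l i j => f i j k l, e f, Finset.sum_comm]

lemma ip_End (R : Module.End ℝ (so n)) (X Y : so n) : ip (R X) Y
    = 1 / 4 * ∑ i, ∑ j, ∑ k, ∑ l, (X : Mat n) i j * (Y : Mat n) k l * Rcoord R i j k l := by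
  rw [ip_eq, ← sum_comm_pairs]
  simp only [End_apply, Finset.mul_sum, Finset.sum_mul]
  refine Finset.sum_congr rfl fun k _ => Finset.sum_congr rfl fun l _ =>
    Finset.sum_congr rfl fun i _ => Finset.sum_congr rfl fun j _ => ?_
  ring

lemma sum_pairs (f : Fin n → Fin n → ℝ) (h : ∀ i j, f j i = f i j) (h0 : ∀ i, f i i = 0) :
    ∑ p ∈ pairs n, f p.1 p.2 = 1 / 2 * ∑ i, ∑ j, f i j := by
  have e : ∑ i, ∑ j, f i j = ∑ p : Fin n × Fin n, f p.1 p.2 := (Fintype.sum_prod_type' f).symm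
  have e2 : ∑ p : Fin n × Fin n, f p.1 p.2 = ∑ p : Fin n × Fin n,
      ((if p.1 < p.2 then f p.1 p.2 else 0) + if p.2 < p.1 then f p.1 p.2 else 0) := by
    refine Finset.sum_congr rfl fun p _ => ?_
    rcases lt_trichotomy p.1 p.2 with h1 | h1 | h1
    · simp [h1, h1.not_gt]
    · simp [h1, h0]
    · simp [h1, h1.not_gt]
  have e3 : ∑ p : Fin n × Fin n, (if p.2 < p.1 then f p.1 p.2 else 0)
      = ∑ p : Fin n × Fin n, (if p.1 < p.2 then f p.1 p.2 else 0) := by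
    refine Fintype.sum_equiv (Equiv.prodComm _ _) _ _ fun p => ?_
    simp [h p.1 p.2]
  rw [e, e2, Finset.sum_add_distrib, e3, pairs, Finset.sum_filter]; ring

/-- The algebraic symmetries of curvature tensors, in coordinates. -/
structure CurvLike (r : Fin n → Fin n → Fin n → Fin n → ℝ) : Prop where
  skew : ∀ i j k l, r j i k l = -r i j k l
  symm : ∀ i j k l, r k l i j = r i j k l
  bianchi : ∀ i j k l, r i j k l + r j k i l + r k i j l = 0

lemma CurvLike.skew' {r : Fin n → Fin n → Fin n → Fin n → ℝ} (h : CurvLike r) (i j k l : Fin n) :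
    r i j l k = -r i j k l := by
  rw [← h.symm, h.skew, h.symm]

lemma isCurvOp.curvLike {R : Module.End ℝ (so n)} (h : isCurvOp R) : CurvLike (Rcoord R) where
  skew := Rcoord_skew_left R
  symm i j k l := by
    rw [Rcoord, h.1, Rcoord_eq, ip_eq]
    rw [show (1 / 2 * ∑ a, ∑ b, (bvec k l : Mat n) a b * (R (bvec i j) : Mat n) a b)
      = ip (R (bvec i j)) (bvec k l) by rw [ip_eq]; simp only [mul_comm], ip_bvec]
  bianchi := h.2

lemma CurvLike.isCurvOp {R : Module.End ℝ (so n)} (h : CurvLike (Rcoord R)) : isCurvOp R := by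
  refine ⟨fun X Y => ?_, h.bianchi⟩
  have e : ip X (R Y) = ip (R Y) X := by rw [ip_eq, ip_eq]; simp only [mul_comm]
  rw [e, ip_End, ip_End, ← sum_comm_pairs]
  simp only [h.symm, mul_comm]

/-- The bilinear form on tensors whose diagonal is `R ↦ R² + R^#`. -/
def qb (r s : Fin n → Fin n → Fin n → Fin n → ℝ) (i j k l : Fin n) : ℝ :=
  ∑ p, ∑ q, (1 / 2 * (r i j p q * s p q k l) + r i p k q * s j p l q - r i p l q * s j p k q)

lemma brk_apply (A B : so n) (i j : Fin n) : (brk A B : Mat n) i j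
    = ∑ x, ((A : Mat n) i x * (B : Mat n) x j - (B : Mat n) i x * (A : Mat n) x j) := by
  simp only [brk, Matrix.sub_apply, Matrix.mul_apply, Finset.sum_sub_distrib]

lemma brk_neg_left (A B : so n) : brk (-A) B = -brk A B := by
  ext i j; simp [brk]; ring

lemma brk_neg_right (A B : so n) : brk A (-B) = -brk A B := by
  ext i j; simp [brk]; ring

lemma bvec_self (i : Fin n) : bvec i i = 0 := by
  ext k l; rw [bvec_apply]; simp

lemma sum_bvec (g : Fin n → Fin n → ℝ) (h : ∀ a b, g b a = -g a b) (k l : Fin n) :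
    ∑ a, ∑ b, g a b * (bvec a b : Mat n) k l = 2 * g k l := by
  simp only [bvec_apply, mul_sub, Finset.sum_sub_distrib, Matrix.one_apply, mul_ite,
    mul_one, mul_zero, Finset.sum_ite_eq', Finset.mem_univ, if_true,
    Finset.sum_ite_irrel, Finset.sum_const_zero]
  rw [h k l]; ring

lemma sum_bvec_bvec (g : Fin n → Fin n → Fin n → Fin n → ℝ) (h1 : ∀ a b c d, g b a c d = -g a b c d)
    (h2 : ∀ a b c d, g a b d c = -g a b c d) (k x y l : Fin n) :
    ∑ a, ∑ b, ∑ c, ∑ d, g a b c d * ((bvec a b : Mat n) k x * (bvec c d : Mat n) y l)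
      = 4 * g k x y l := by
  have e (a b : Fin n) :
      ∑ c, ∑ d, g a b c d * ((bvec a b : Mat n) k x * (bvec c d : Mat n) y l)
      = 2 * g a b y l * (bvec a b : Mat n) k x := by
    rw [← sum_bvec (fun c d => g a b c d) (h2 a b), Finset.sum_mul]
    refine Finset.sum_congr rfl fun c _ => ?_
    rw [Finset.sum_mul]
    exact Finset.sum_congr rfl fun d _ => by ring
  simp only [e]
  rw [sum_bvec (fun a b => 2 * g a b y l) (fun a b => by rw [h1]; ring)]; ring

lemma sum_rotate {α β γ : Type*} [Fintype α] [Fintype β] [Fintype γ] (f : α → β → γ → ℝ) :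
    ∑ a, ∑ b, ∑ x, f a b x = ∑ x, ∑ a, ∑ b, f a b x := by
  calc ∑ a, ∑ b, ∑ x, f a b x = ∑ a, ∑ x, ∑ b, f a b x :=
        Finset.sum_congr rfl fun a _ => Finset.sum_comm
    _ = ∑ x, ∑ a, ∑ b, f a b x := Finset.sum_comm

/-- Contraction of a doubly skew family with the brackets of `eₐ ∧ e_b` and `e_c ∧ e_d`. -/
lemma sum_brk_bvec (g : Fin n → Fin n → Fin n → Fin n → ℝ) (h1 : ∀ a b c d, g b a c d = -g a b c d)
    (h2 : ∀ a b c d, g a b d c = -g a b c d) (k l : Fin n) :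
    ∑ a, ∑ b, ∑ c, ∑ d, g a b c d * (brk (bvec a b) (bvec c d) : Mat n) k l
      = 4 * ∑ x, (g k x x l - g x l k x) := by
  simp only [mul_sub, ← sum_bvec_bvec g h1 h2, Finset.mul_sum, brk_apply]
  have e (f : Fin n → Fin n → Fin n → Fin n → Fin n → ℝ) :
      ∑ a, ∑ b, ∑ c, ∑ d, ∑ x, f a b c d x = ∑ x, ∑ a, ∑ b, ∑ c, ∑ d, f a b c d x := by
    rw [← sum_rotate fun a b x => ∑ c, ∑ d, f a b c d x]
    exact Finset.sum_congr rfl fun a _ => Finset.sum_congr rfl fun b _ => sum_rotate _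
  rw [e]
  simp only [← Finset.sum_sub_distrib, mul_comm]

lemma sum_pairs_pairs (f : Fin n → Fin n → Fin n → Fin n → ℝ)
    (h1 : ∀ a b c d, f b a c d = f a b c d) (h2 : ∀ a b c d, f a b d c = f a b c d)
    (h3 : ∀ a c d, f a a c d = 0) (h4 : ∀ a b c, f a b c c = 0) :
    ∑ p ∈ pairs n, ∑ q ∈ pairs n, f p.1 p.2 q.1 q.2 = 1 / 4 * ∑ a, ∑ b, ∑ c, ∑ d, f a b c d := by
  have e (a b : Fin n) := sum_pairs (fun c d => f a b c d) (h2 a b) (h4 a b)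
  simp only [e]
  rw [sum_pairs (fun a b => 1 / 2 * ∑ c, ∑ d, f a b c d) (fun i j => by simp only [h1])
    (fun i => by simp only [h3]; simp)]
  simp only [← Finset.mul_sum]; ring

lemma sharp_apply (R : Module.End ℝ (so n)) (i j k l : Fin n) : Rcoord (sharp R R) i j k l
    = 1 / 4 * ∑ x, (((brk (R (bvec k x)) (R (bvec x l)) : so n) : Mat n) i j
        - ((brk (R (bvec x l)) (R (bvec k x)) : so n) : Mat n) i j
        + (((brk (R (bvec i x)) (R (bvec x j)) : so n) : Mat n) k l
        - ((brk (R (bvec x j)) (R (bvec i x)) : so n) : Mat n) k l)) := by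
  have e := sum_pairs_pairs (fun a b c d => ((brk (R (bvec a b)) (R (bvec c d)) : so n) : Mat n) i j
      * ((brk (bvec a b) (bvec c d) : so n) : Mat n) k l
      + ((brk (bvec a b) (bvec c d) : so n) : Mat n) i j
      * ((brk (R (bvec a b)) (R (bvec c d)) : so n) : Mat n) k l)
    (fun a b c d => by simp [bvec_swap a b, brk_neg_left])
    (fun a b c d => by simp [bvec_swap c d, brk_neg_right])
    (fun a c d => by simp [bvec_self, brk])
    (fun a c d => by simp [bvec_self, brk])
  have e2 (u v : Fin n) := sum_brk_bvec
    (fun a b c d => ((brk (R (bvec a b)) (R (bvec c d)) : so n) : Mat n) u v)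
    (fun a b c d => by simp [bvec_swap a b, brk_neg_left])
    (fun a b c d => by simp [bvec_swap c d, brk_neg_right])
  rw [Rcoord_eq, sharp]
  simp only [LinearMap.smul_apply, LinearMap.sum_apply, LinearMap.add_apply,
    LinearMap.smulRight_apply, Submodule.coe_smul, Submodule.coe_sum, Submodule.coe_add,
    Matrix.smul_apply, Matrix.sum_apply, Matrix.add_apply, smul_eq_mul, ipL, LinearMap.coe_mk,
    AddHom.coe_mk, ip_bvec]
  rw [e]
  simp only [Finset.sum_add_distrib, mul_comm _ (((brk (R (bvec _ _)) _ : so n) : Mat n) k l), e2,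
    Finset.sum_sub_distrib]
  ring

lemma Qode_apply {R : Module.End ℝ (so n)} (h : CurvLike (Rcoord R)) (i j k l : Fin n) :
    Rcoord (Qode R) i j k l = qb (Rcoord R) (Rcoord R) i j k l := by
  have e : Rcoord (Qode R) i j k l = Rcoord (R * R) i j k l + Rcoord (sharp R R) i j k l := by
    simp only [Rcoord_eq, Qode, LinearMap.add_apply, Submodule.coe_add, Matrix.add_apply]
  rw [e, sharp_apply, Rcoord_eq, Module.End.mul_apply, End_apply]
  simp only [brk_apply, ← Rcoord_eq, qb, Finset.sum_add_distrib, Finset.sum_sub_distrib,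
    Finset.mul_sum, mul_add, mul_sub]
  have c (f : Fin n → Fin n → ℝ) : ∑ x, ∑ y, f x y = ∑ x, ∑ y, f y x := Finset.sum_comm
  have t1 : ∑ x, ∑ y, 1 / 4 * (Rcoord R k x i y * Rcoord R x l y j)
      = 1 / 4 * ∑ x, ∑ y, Rcoord R i x k y * Rcoord R j x l y := by
    rw [c]; simp only [Finset.mul_sum]
    refine Finset.sum_congr rfl fun x _ => Finset.sum_congr rfl fun y _ => ?_
    rw [← h.symm k y i x, ← h.symm y l x j, h.skew j x, h.skew' j x y l]
  have t2 : ∑ x, ∑ y, 1 / 4 * (Rcoord R x l i y * Rcoord R k x y j)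
      = 1 / 4 * ∑ x, ∑ y, Rcoord R i x l y * Rcoord R j x k y := by
    rw [c]; simp only [Finset.mul_sum]
    refine Finset.sum_congr rfl fun x _ => Finset.sum_congr rfl fun y _ => ?_
    rw [← h.symm y l i x, ← h.symm k y x j, h.skew j x, h.skew' i x l y]; ring
  have t3 : ∑ x, ∑ y, 1 / 4 * (Rcoord R i x k y * Rcoord R x j y l)
      = 1 / 4 * ∑ x, ∑ y, Rcoord R i x k y * Rcoord R j x l y := by
    simp only [Finset.mul_sum]
    refine Finset.sum_congr rfl fun x _ => Finset.sum_congr rfl fun y _ => ?_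
    rw [h.skew j x, h.skew' j x l y]; ring
  have t4 : ∑ x, ∑ y, 1 / 4 * (Rcoord R x j k y * Rcoord R i x y l)
      = 1 / 4 * ∑ x, ∑ y, Rcoord R i x l y * Rcoord R j x k y := by
    simp only [Finset.mul_sum]
    refine Finset.sum_congr rfl fun x _ => Finset.sum_congr rfl fun y _ => ?_
    rw [h.skew j x, h.skew' i x l y]; ring
  rw [t1, t2, t3, t4]; ring

/-- The contraction `B_{ijkl} = ∑ r_{ipjq} r_{kplq}`. -/
def bb (r : Fin n → Fin n → Fin n → Fin n → ℝ) (i j k l : Fin n) : ℝ :=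
  ∑ p, ∑ q, r i p j q * r k p l q

lemma CurvLike.bb_swap {r : Fin n → Fin n → Fin n → Fin n → ℝ} (h : CurvLike r) (i j k l : Fin n) :
    bb r j i l k = bb r i j k l := by
  rw [bb, Finset.sum_comm, bb]
  refine Finset.sum_congr rfl fun p _ => Finset.sum_congr rfl fun q _ => ?_
  rw [h.symm i p j q, h.symm k p l q]

lemma bb_comm (r : Fin n → Fin n → Fin n → Fin n → ℝ) (i j k l : Fin n) :
    bb r k l i j = bb r i j k l := by
  simp only [bb, mul_comm]

lemma CurvLike.qb_eq {r : Fin n → Fin n → Fin n → Fin n → ℝ} (h : CurvLike r) (i j k l : Fin n) :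
    qb r r i j k l = bb r i j k l - bb r i j l k + bb r i k j l - bb r i l j k := by
  have e : ∑ p, ∑ q, r i p j q * r l p k q = ∑ p, ∑ q, r i q j p * r l q k p := Finset.sum_comm
  have e1 : ∑ p, ∑ q, r i p j q * r k p l q = ∑ p, ∑ q, r i q j p * r k q l p := Finset.sum_comm
  have key : ∑ p, ∑ q, 1 / 2 * (r i j p q * r p q k l) = bb r i j k l - bb r i j l k := by
    have e2 : ∑ p, ∑ q, 1 / 2 * (r i j p q * r p q k l) = ∑ p, ∑ q, 1 / 2 *
        (r i p j q * r k p l q - r i q j p * r l q k p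
          - r i p j q * r l p k q + r i q j p * r k q l p) := by
      refine Finset.sum_congr rfl fun p _ => Finset.sum_congr rfl fun q _ => ?_
      have a1 : r i j p q = r i p j q - r i q j p := by
        have := h.bianchi i j p q
        rw [h.skew i p, ← h.symm j p i q] at this; linarith
      have a2 : r p q k l = r k p l q - r k q l p := by
        have := h.bianchi k l p q
        rw [h.skew k p, ← h.symm l p k q] at this; rw [← h.symm]; linarith
      have a3 : r k q l p = r l p k q := by rw [h.symm]
      have a4 : r l q k p = r k p l q := by rw [h.symm]
      rw [a1, a2, a4, a3]; ring
    rw [e2]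
    simp only [bb, mul_add, mul_sub, Finset.sum_add_distrib, Finset.sum_sub_distrib,
      ← Finset.mul_sum]
    linarith
  simp only [qb, Finset.sum_add_distrib, Finset.sum_sub_distrib] at key ⊢
  rw [key]; simp only [bb]

lemma CurvLike.qb_self {r : Fin n → Fin n → Fin n → Fin n → ℝ} (h : CurvLike r) :
    CurvLike (qb r r) where
  skew i j k l := by
    simp only [h.qb_eq]
    linarith [h.bb_swap i j k l, h.bb_swap i j l k, bb_comm r i k j l, bb_comm r i l j k]
  symm i j k l := by
    simp only [h.qb_eq]
    linarith [bb_comm r i j k l, bb_comm r i j l k, h.bb_swap i k j l, bb_comm r i l j k,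
      h.bb_swap k j l i, bb_comm r j i k l,
      h.bb_swap i j l k, h.bb_swap i l j k]
  bianchi i j k l := by
    simp only [h.qb_eq]
    linarith [bb_comm r i j k l, h.bb_swap i j l k, h.bb_swap k i j l, h.bb_swap i k j l,
      bb_comm r i l j k, h.bb_swap k i l j, h.bb_swap i l j k, h.bb_swap j k i l,
      bb_comm r j l i k, bb_comm r i k j l, bb_comm r k i l j, bb_comm r j k l i,
      h.bb_swap j k l i, bb_comm r j k i l, bb_comm r j l k i]

/-- The Kulkarni–Nomizu product of two symmetric matrices. -/
def knn (A B : Mat n) (i j k l : Fin n) : ℝ :=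
  A i k * B j l + A j l * B i k - A i l * B j k - A j k * B i l

/-- The contraction `∑ r_{ipkq} H_{pq}` of a tensor with a matrix. -/
def contrT (r : Fin n → Fin n → Fin n → Fin n → ℝ) (H : Mat n) : Mat n :=
  Matrix.of fun i k => ∑ p, ∑ q, r i p k q * H p q

/-- The Ricci contraction. -/
def ricT (r : Fin n → Fin n → Fin n → Fin n → ℝ) : Mat n :=
  Matrix.of fun i j => ∑ k, r i k j k

lemma contr_knn_left (t : Fin n → Fin n → ℝ) (H : Mat n) (k l : Fin n) :
    ∑ p, ∑ q, t p q * knn H 1 p q k l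
      = ∑ x, (t x l * H x k + t k x * H x l - t x k * H x l - t l x * H x k) := by
  simp only [knn, mul_add, mul_sub, Finset.sum_add_distrib, Finset.sum_sub_distrib,
    Matrix.one_apply, mul_ite, mul_one, mul_zero, Finset.sum_ite_eq', Finset.mem_univ, if_true,
    Finset.sum_ite_irrel, Finset.sum_const_zero]

lemma contr_knn_mid (t : Fin n → Fin n → ℝ) (H : Mat n) (j l : Fin n) :
    ∑ p, ∑ q, t p q * knn H 1 j p l q
      = H j l * ∑ p, t p p + (1 : Mat n) j l * ∑ p, ∑ q, t p q * H p q
        - ∑ x, (t l x * H j x + t x j * H x l) := by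
  simp only [knn, mul_add, mul_sub, Finset.sum_add_distrib, Finset.sum_sub_distrib,
    Matrix.one_apply, mul_ite, mul_one, mul_zero, Finset.sum_ite_eq', Finset.sum_ite_eq,
    Finset.mem_univ, if_true, ite_mul, zero_mul, one_mul, Finset.mul_sum,
    Finset.sum_ite_irrel, Finset.sum_const_zero]
  simp only [mul_comm]; ring

lemma curvLike_knn {A B : Mat n} (hA : ∀ i j, A j i = A i j) (hB : ∀ i j, B j i = B i j) :
    CurvLike (knn A B) where
  skew i j k l := by simp only [knn]; ring
  symm i j k l := by
    simp only [knn]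
    rw [hA i k, hA j l, hA j k, hA i l, hB i k, hB j l, hB j k, hB i l]; ring
  bianchi i j k l := by simp only [knn]; rw [hA j i, hA k i, hA k j, hB j i, hB k i, hB k j]; ring

lemma cross_knn {r : Fin n → Fin n → Fin n → Fin n → ℝ} (h : CurvLike r) {H : Mat n}
    (hH : ∀ i j, H j i = H i j) (i j k l : Fin n) :
    qb r (knn H 1) i j k l + qb (knn H 1) r i j k l
      = knn H (ricT r) i j k l + knn (contrT r H) 1 i j k l := by
  have hK := curvLike_knn hH (B := 1) (fun i j => by simp [Matrix.one_apply, eq_comm])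
  have e1 : qb r (knn H 1) i j k l = 1 / 2 * ∑ p, ∑ q, r i j p q * knn H 1 p q k l
      + ∑ p, ∑ q, r i p k q * knn H 1 j p l q - ∑ p, ∑ q, r i p l q * knn H 1 j p k q := by
    simp only [qb, Finset.sum_add_distrib, Finset.sum_sub_distrib, Finset.mul_sum]
  have e2 : qb (knn H 1) r i j k l = 1 / 2 * ∑ p, ∑ q, r p q k l * knn H 1 p q i j
      + ∑ p, ∑ q, r j p l q * knn H 1 i p k q - ∑ p, ∑ q, r j p k q * knn H 1 i p l q := by
    simp only [qb, Finset.sum_add_distrib, Finset.sum_sub_distrib, Finset.mul_sum, hK.symm,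
      mul_comm]
  rw [e1, e2]
  simp only [contr_knn_left, contr_knn_mid]
  simp only [knn, ricT, contrT, Matrix.of_apply]
  have key : ∑ x, (1 / 2 * (r i j x l * H x k + r i j k x * H x l - r i j x k * H x l
      - r i j l x * H x k) - (r i l k x * H j x + r i x k j * H x l)
      + (r i k l x * H j x + r i x l j * H x k)
      + 1 / 2 * (r x j k l * H x i + r i x k l * H x j - r x i k l * H x j - r j x k l * H x i)
      - (r j k l x * H i x + r j x l i * H x k)
      + (r j l k x * H i x + r j x k i * H x l)) = 0 := by
    refine Finset.sum_eq_zero fun x _ => ?_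
    have b (a b c d : Fin n) : r a b c d = r a c b d - r a d b c := by
      have := h.bianchi a b c d
      rw [h.skew a c, ← h.symm b c a d] at this; linarith
    rw [b i j x l, b i j l x, b i j x k, b i j k x, b x j k l, b j x k l, b i x k l, b x i k l]
    rw [h.symm i l x k, h.symm i k x l, h.symm j l x k, h.symm j k x l,
      ← h.symm j x l i, ← h.symm j x k i, h.skew i l, h.skew i k,
      h.skew' i x j l, h.skew' i x j k, h.skew' i l k x, h.skew' i k l x,
      h.skew' j l k x, h.skew' j k l x, hH x j, hH x i]
    ring
  simp only [Finset.sum_add_distrib, Finset.sum_sub_distrib, ← Finset.mul_sum] at key ⊢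
  linear_combination key

lemma Rcoord_add (R S : Module.End ℝ (so n)) (i j k l : Fin n) :
    Rcoord (R + S) i j k l = Rcoord R i j k l + Rcoord S i j k l := by
  simp only [Rcoord_eq, LinearMap.add_apply, Submodule.coe_add, Matrix.add_apply]

lemma Rcoord_smul (c : ℝ) (R : Module.End ℝ (so n)) (i j k l : Fin n) :
    Rcoord (c • R) i j k l = c * Rcoord R i j k l := by
  simp only [Rcoord_eq, LinearMap.smul_apply, Submodule.coe_smul, Matrix.smul_apply, smul_eq_mul]

lemma wedge_apply (A B : Mat n) (X : so n) : ((wedge A B X : so n) : Mat n)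
    = (1 / 2 : ℝ) • (A * (X : Mat n) * Bᵀ + B * (X : Mat n) * Aᵀ) := rfl

lemma Rcoord_wedge {A B : Mat n} (hA : ∀ i j, A j i = A i j) (hB : ∀ i j, B j i = B i j)
    (i j k l : Fin n) : Rcoord (wedge A B) i j k l = 1 / 2 * knn A B i j k l := by
  have e (C D : Mat n) : (C * (bvec i j : Mat n) * Dᵀ) k l = C k i * D l j - C k j * D l i := by
    simp only [Matrix.mul_apply, bvec_apply, Matrix.transpose_apply, mul_sub, sub_mul,
      Finset.sum_sub_distrib, Matrix.one_apply, mul_ite, ite_mul, mul_one, mul_zero, zero_mul,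
      Finset.sum_ite_eq, Finset.mem_univ, if_true, Finset.sum_ite_irrel,
      Finset.sum_const_zero]
  rw [Rcoord_eq, wedge_apply, Matrix.smul_apply, Matrix.add_apply, e, e, knn, hA i k, hA j k,
    hA i l, hA j l, hB i k, hB j k, hB i l, hB j l, smul_eq_mul]
  ring

lemma RicM_eq (R : Module.End ℝ (so n)) : RicM R = ricT (Rcoord R) := rfl

lemma RicM_add (R S : Module.End ℝ (so n)) : RicM (R + S) = RicM R + RicM S := by
  ext i j
  simp only [RicM, Matrix.of_apply, Rcoord_add, Finset.sum_add_distrib, Matrix.add_apply]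

lemma RicM_smul (c : ℝ) (R : Module.End ℝ (so n)) : RicM (c • R) = c • RicM R := by
  ext i j
  simp only [RicM, Matrix.of_apply, Rcoord_smul, ← Finset.mul_sum, Matrix.smul_apply, smul_eq_mul]

lemma CurvLike.ricT_symm {r : Fin n → Fin n → Fin n → Fin n → ℝ} (h : CurvLike r) (i j : Fin n) :
    ricT r j i = ricT r i j := by
  simp only [ricT, Matrix.of_apply]
  exact Finset.sum_congr rfl fun k _ => h.symm _ _ _ _

lemma ricT_knn {A B : Mat n} (hA : ∀ i j, A j i = A i j) (i j : Fin n) :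
    ricT (knn A B) i j = A i j * B.trace + A.trace * B i j - (A * B) i j - (B * A) i j := by
  simp only [ricT, knn, Matrix.of_apply, Matrix.trace, Matrix.diag_apply, Matrix.mul_apply,
    Finset.sum_add_distrib, Finset.sum_sub_distrib, Finset.mul_sum, Finset.sum_mul]
  simp only [hA j, mul_comm]

lemma contrT_knn {H : Mat n} (hH : ∀ i j, H j i = H i j) (i k : Fin n) :
    contrT (knn H 1) H i k = H.trace * H i k + (H * H).trace * (1 : Mat n) i k
      - 2 * (H * H) i k := by
  have e := contr_knn_mid (fun p q => H p q) H i k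
  have e1 : contrT (knn H 1) H i k = ∑ p, ∑ q, H p q * knn H 1 i p k q := by
    simp only [contrT, Matrix.of_apply, mul_comm]
  rw [e1, e]
  simp only [Matrix.trace, Matrix.diag_apply, Matrix.mul_apply, Finset.sum_add_distrib]
  have e2 : ∑ x, H k x * H i x = ∑ x, H i x * H x k :=
    Finset.sum_congr rfl fun x _ => by rw [hH k x]; ring
  have e3 : ∑ x, H x i * H x k = ∑ x, H i x * H x k :=
    Finset.sum_congr rfl fun x _ => by rw [hH i x]
  have e4 : ∑ p, ∑ q, H p q * H p q = ∑ p, ∑ q, H p q * H q p :=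
    Finset.sum_congr rfl fun x _ => Finset.sum_congr rfl fun y _ => by rw [hH x y]
  rw [e2, e3, e4]; ring

lemma CurvLike.ricT_qb {r : Fin n → Fin n → Fin n → Fin n → ℝ} (h : CurvLike r) :
    ricT (qb r r) = contrT r (ricT r) := by
  ext i j
  have h1 : ∑ k, bb r i j k k = contrT r (ricT r) i j := by
    simp only [bb, contrT, ricT, Matrix.of_apply, Finset.mul_sum]
    rw [sum_rotate fun p q k => r i p j q * r p k q k]
    refine Finset.sum_congr rfl fun x _ => Finset.sum_congr rfl fun y _ =>
      Finset.sum_congr rfl fun z _ => ?_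
    rw [h.skew y x, h.skew' y x z x, neg_neg]
  have h2 : ∑ k, bb r i k j k = 2 * ∑ k, bb r i k k j := by
    have s2 : ∑ k, bb r i k k j = ∑ k, ∑ p, ∑ q, r i p k q * r j q k p := by
      simp only [bb]
      refine Finset.sum_congr rfl fun x _ => Finset.sum_congr rfl fun y _ =>
        Finset.sum_congr rfl fun z _ => ?_
      rw [h.symm j z x y]
    have s3 : ∑ k, ∑ p, ∑ q, r i p k q * r j k p q = ∑ k, ∑ p, ∑ q, r i p k q * r j q k p := by
      rw [← sum_rotate fun p q k => r i p k q * r j k p q,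
        ← sum_rotate fun p q k => r i p k q * r j q k p]
      refine Finset.sum_congr rfl fun p _ => ?_
      rw [Finset.sum_comm]
      refine Finset.sum_congr rfl fun q _ => Finset.sum_congr rfl fun k _ => ?_
      rw [h.skew' i p k q, h.skew' j q k p]; ring
    have s4 : ∑ k, ∑ p, ∑ q, (r i p k q * r j p k q - r i p k q * r j k p q
        - r i p k q * r j q k p) = 0 := by
      refine Finset.sum_eq_zero fun k _ => Finset.sum_eq_zero fun p _ =>
        Finset.sum_eq_zero fun q _ => ?_
      have := h.bianchi j p k q
      rw [h.skew j k p q, ← h.symm p k j q, h.skew' j q k p] at this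
      linear_combination r i p k q * this
    simp only [Finset.sum_sub_distrib] at s4
    rw [s2]
    simp only [bb]
    linarith
  have e (k : Fin n) := h.qb_eq i k j k
  rw [← h1]
  simp only [ricT, Matrix.of_apply, e, Finset.sum_add_distrib, Finset.sum_sub_distrib]
  linarith

/-- The symmetric matrix `H` with `ℓ_{a,b}(R) = R + 2 H ∧ id`. -/
def labMat (a b : ℝ) (R : Module.End ℝ (so n)) : Mat n := (a * lamb R) • 1 + b • Ric0 R

lemma Ric0_symm {R : Module.End ℝ (so n)} (h : CurvLike (Rcoord R)) (i j : Fin n) :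
    Ric0 R j i = Ric0 R i j := by
  have := h.ricT_symm i j
  simp only [Ric0, RicM_eq, Matrix.sub_apply, Matrix.smul_apply, this, Matrix.one_apply,
    eq_comm (a := i)]

lemma labMat_symm (a b : ℝ) {R : Module.End ℝ (so n)} (h : CurvLike (Rcoord R)) (i j : Fin n) :
    labMat a b R j i = labMat a b R i j := by
  simp only [labMat, Matrix.add_apply, Matrix.smul_apply, Ric0_symm h i j, Matrix.one_apply,
    eq_comm (a := i)]

lemma one_symm (i j : Fin n) : (1 : Mat n) j i = (1 : Mat n) i j := by
  simp [Matrix.one_apply, eq_comm]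

lemma Rcoord_lab (hn : 3 ≤ n) (a b : ℝ) {R : Module.End ℝ (so n)} (h : CurvLike (Rcoord R))
    (i j k l : Fin n) : Rcoord (lab a b R) i j k l
      = Rcoord R i j k l + knn (labMat a b R) 1 i j k l := by
  have h3 : (3 : ℝ) ≤ n := by exact_mod_cast hn
  have h1 : (n : ℝ) - 1 ≠ 0 := by linarith
  have h2 : (n : ℝ) - 2 ≠ 0 := by linarith
  simp only [lab, RI, RRic0, Rcoord_add, Rcoord_smul, Rcoord_wedge one_symm one_symm,
    Rcoord_wedge (Ric0_symm h) one_symm, knn, labMat, Matrix.add_apply, Matrix.smul_apply,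
    smul_eq_mul]
  field_simp
  ring

/-- The quadratic curvature-like operator `D` in the Ricci tensor with
`Q(ℓ(R)) = ℓ(Q(R) + D(R))` for `ℓ = ℓ_{(1+s)/2, 1/2}`. -/
def defect (s : ℝ) (R : Module.End ℝ (so n)) : Module.End ℝ (so n) :=
  (((n : ℝ) - 2) / 4 - s) • wedge (Ric0 R) (Ric0 R) + (1 + s) • wedge (RicM R) (RicM R)
    + (1 / 2 : ℝ) • wedge (Ric0 R * Ric0 R) 1
    + (-(sigmaR R * (s * n / (4 * (n + (n - 1) * s))))) • wedge 1 1

lemma mul_self_symm {A : Mat n} (hA : ∀ i j, A j i = A i j) (i j : Fin n) :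
    (A * A) j i = (A * A) i j := by
  simp only [Matrix.mul_apply]
  exact Finset.sum_congr rfl fun k _ => by rw [hA k j, hA i k]; ring

lemma RicM_symm {R : Module.End ℝ (so n)} (h : CurvLike (Rcoord R)) (i j : Fin n) :
    RicM R j i = RicM R i j := h.ricT_symm i j

lemma Rcoord_defect (s : ℝ) {R : Module.End ℝ (so n)} (h : CurvLike (Rcoord R))
    (i j k l : Fin n) : Rcoord (defect s R) i j k l
      = 1 / 2 * (((n : ℝ) - 2) / 4 - s) * knn (Ric0 R) (Ric0 R) i j k l
        + 1 / 2 * (1 + s) * knn (RicM R) (RicM R) i j k l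
        + 1 / 4 * knn (Ric0 R * Ric0 R) 1 i j k l
        - 1 / 2 * (sigmaR R * (s * n / (4 * (n + (n - 1) * s)))) * knn 1 1 i j k l := by
  simp only [defect, Rcoord_add, Rcoord_smul, Rcoord_wedge one_symm one_symm,
    Rcoord_wedge (Ric0_symm h) (Ric0_symm h), Rcoord_wedge (RicM_symm h) (RicM_symm h),
    Rcoord_wedge (mul_self_symm (Ric0_symm h)) one_symm]
  ring

lemma ricT_add (r t : Fin n → Fin n → Fin n → Fin n → ℝ) (i j : Fin n) :
    ricT (fun i j k l => r i j k l + t i j k l) i j = ricT r i j + ricT t i j := by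
  simp only [ricT, Matrix.of_apply, Finset.sum_add_distrib]

lemma RicM_wedge {A B : Mat n} (hA : ∀ i j, A j i = A i j) (hB : ∀ i j, B j i = B i j)
    (i j : Fin n) : RicM (wedge A B) i j
      = 1 / 2 * (A i j * B.trace + A.trace * B i j - (A * B) i j - (B * A) i j) := by
  rw [← ricT_knn hA, RicM_eq]
  simp only [ricT, Matrix.of_apply, Rcoord_wedge hA hB, Finset.mul_sum]

lemma trace_Ric0 (hn : 3 ≤ n) (R : Module.End ℝ (so n)) : (Ric0 R).trace = 0 := by
  have h3 : (n : ℝ) ≠ 0 := by positivity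
  simp only [Ric0, Matrix.trace_sub, Matrix.trace_smul, Matrix.trace_one, lamb, Fintype.card_fin,
    smul_eq_mul]
  field_simp; ring

lemma RicM_split (R : Module.End ℝ (so n)) : RicM R = Ric0 R + lamb R • 1 := by
  simp [Ric0]

lemma trace_RicM (hn : 3 ≤ n) (R : Module.End ℝ (so n)) : (RicM R).trace = n * lamb R := by
  have h3 : (n : ℝ) ≠ 0 := by positivity
  rw [lamb]; field_simp

lemma trace_Ric0_sq (hn : 3 ≤ n) (R : Module.End ℝ (so n)) :
    (Ric0 R * Ric0 R).trace = n * sigmaR R := by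
  have h3 : (n : ℝ) ≠ 0 := by positivity
  rw [sigmaR]; field_simp

lemma RicM_sq (R : Module.End ℝ (so n)) : RicM R * RicM R
    = Ric0 R * Ric0 R + (2 * lamb R) • Ric0 R + (lamb R ^ 2) • (1 : Mat n) := by
  rw [RicM_split]
  simp only [add_mul, mul_add, smul_mul_assoc, mul_smul_comm, one_mul, mul_one]
  module

lemma RicM_defect (hn : 3 ≤ n) (s : ℝ) {R : Module.End ℝ (so n)} (h : CurvLike (Rcoord R)) :
    RicM (defect s R) = -(Ric0 R * Ric0 R) + ((1 + s) * (n - 2) * lamb R) • Ric0 R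
      + ((1 + s) * (n - 1) * lamb R ^ 2 + sigmaR R * (n / 4)
        - sigmaR R * (s * n / (4 * (n + (n - 1) * s))) * (n - 1)) • (1 : Mat n) := by
  ext i j
  simp only [defect, RicM_add, RicM_smul, Matrix.add_apply, Matrix.smul_apply, smul_eq_mul,
    RicM_wedge one_symm one_symm, Matrix.neg_apply,
    RicM_wedge (Ric0_symm h) (Ric0_symm h), RicM_wedge (RicM_symm h) (RicM_symm h),
    RicM_wedge (mul_self_symm (Ric0_symm h)) one_symm, trace_Ric0 hn, trace_RicM hn, RicM_sq,
    trace_Ric0_sq hn, one_mul, mul_one, Matrix.trace_one, Fintype.card_fin]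
  rw [RicM_split R]
  simp only [Matrix.add_apply, Matrix.smul_apply, smul_eq_mul]
  ring

lemma RicM_Qode {R : Module.End ℝ (so n)} (h : CurvLike (Rcoord R)) :
    RicM (Qode R) = contrT (Rcoord R) (RicM R) := by
  rw [RicM_eq R, ← h.ricT_qb]
  ext i j
  simp only [RicM, ricT, Matrix.of_apply, Qode_apply h]

lemma contrT_one (r : Fin n → Fin n → Fin n → Fin n → ℝ) : contrT r 1 = ricT r := by
  ext i j
  simp [contrT, ricT, Matrix.one_apply]

lemma contrT_comb (r : Fin n → Fin n → Fin n → Fin n → ℝ) (x y : ℝ) (A B : Mat n) :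
    contrT r (x • A + y • B) = x • contrT r A + y • contrT r B := by
  ext i j
  simp only [contrT, Matrix.add_apply, Matrix.smul_apply, Matrix.of_apply, smul_eq_mul, mul_add,
    Finset.sum_add_distrib, Finset.mul_sum]
  simp only [mul_left_comm]

lemma trace_contrT {r : Fin n → Fin n → Fin n → Fin n → ℝ} (h : CurvLike r) (A : Mat n) :
    (contrT r A).trace = (A * ricT r).trace := by
  simp only [Matrix.trace, Matrix.diag_apply, contrT, ricT, Matrix.of_apply, Matrix.mul_apply,
    Finset.mul_sum]
  rw [← sum_rotate fun p q i => r i p i q * A p q]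
  refine Finset.sum_congr rfl fun p _ => Finset.sum_congr rfl fun q _ =>
    Finset.sum_congr rfl fun i _ => ?_
  rw [h.skew p i i q, h.skew' p i q i, h.symm p i q i]
  ring

lemma trace_RicM_Qode (hn : 3 ≤ n) {R : Module.End ℝ (so n)} (h : CurvLike (Rcoord R)) :
    (RicM (Qode R)).trace = n * (sigmaR R + lamb R ^ 2) := by
  rw [RicM_Qode h, trace_contrT h, ← RicM_eq, RicM_sq]
  simp only [Matrix.trace_add, Matrix.trace_smul, trace_Ric0 hn, trace_Ric0_sq hn,
    Matrix.trace_one, Fintype.card_fin, smul_eq_mul]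
  ring

lemma curvLike_Qode {R : Module.End ℝ (so n)} (h : CurvLike (Rcoord R)) :
    CurvLike (Rcoord (Qode R)) := by
  have e : Rcoord (Qode R) = qb (Rcoord R) (Rcoord R) := by
    ext i j k l; exact Qode_apply h i j k l
  rw [e]; exact h.qb_self

lemma CurvLike.add {R S : Module.End ℝ (so n)} (h : CurvLike (Rcoord R))
    (h' : CurvLike (Rcoord S)) : CurvLike (Rcoord (R + S)) where
  skew := Rcoord_skew_left _
  symm i j k l := by rw [Rcoord_add, Rcoord_add, h.symm, h'.symm]
  bianchi i j k l := by simp only [Rcoord_add]; linarith [h.bianchi i j k l, h'.bianchi i j k l]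

lemma CurvLike.smul {R : Module.End ℝ (so n)} (h : CurvLike (Rcoord R)) (c : ℝ) :
    CurvLike (Rcoord (c • R)) where
  skew := Rcoord_skew_left _
  symm i j k l := by rw [Rcoord_smul, Rcoord_smul, h.symm]
  bianchi i j k l := by simp only [Rcoord_smul]; linear_combination c * h.bianchi i j k l

lemma CurvLike.wedge {A B : Mat n} (hA : ∀ i j, A j i = A i j) (hB : ∀ i j, B j i = B i j) :
    CurvLike (Rcoord (wedge A B)) where
  skew := Rcoord_skew_left _
  symm i j k l := by simp only [Rcoord_wedge hA hB, (curvLike_knn hA hB).symm i j k l]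
  bianchi i j k l := by
    simp only [Rcoord_wedge hA hB]; linear_combination 1 / 2 * (curvLike_knn hA hB).bianchi i j k l

lemma curvLike_defect (s : ℝ) {R : Module.End ℝ (so n)} (h : CurvLike (Rcoord R)) :
    CurvLike (Rcoord (defect s R)) :=
  ((((CurvLike.wedge (Ric0_symm h) (Ric0_symm h)).smul _).add
    ((CurvLike.wedge (RicM_symm h) (RicM_symm h)).smul _)).add
    ((CurvLike.wedge (mul_self_symm (Ric0_symm h)) one_symm).smul _)).add
    ((CurvLike.wedge one_symm one_symm).smul _)

lemma curvLike_lab (a b : ℝ) {R : Module.End ℝ (so n)} (h : CurvLike (Rcoord R)) :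
    CurvLike (Rcoord (lab a b R)) :=
  (h.add (((CurvLike.wedge one_symm one_symm).smul _).smul _)).add
    (((CurvLike.wedge (Ric0_symm h) one_symm).smul _).smul _)

lemma qb_add_knn {r : Fin n → Fin n → Fin n → Fin n → ℝ} (h : CurvLike r) {H : Mat n}
    (hH : ∀ i j, H j i = H i j) (i j k l : Fin n) :
    qb (fun i j k l => r i j k l + knn H 1 i j k l) (fun i j k l => r i j k l + knn H 1 i j k l)
        i j k l
      = qb r r i j k l + knn H (ricT r) i j k l + knn (contrT r H) 1 i j k l
        + 1 / 2 * (knn H (ricT (knn H 1)) i j k l + knn (contrT (knn H 1) H) 1 i j k l) := by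
  have e1 := cross_knn h hH i j k l
  have e2 := cross_knn (curvLike_knn hH one_symm) hH i j k l
  have e3 : qb (fun i j k l => r i j k l + knn H 1 i j k l)
      (fun i j k l => r i j k l + knn H 1 i j k l) i j k l = qb r r i j k l
      + (qb r (knn H 1) i j k l + qb (knn H 1) r i j k l)
      + qb (knn H 1) (knn H 1) i j k l := by
    simp only [qb, ← Finset.sum_add_distrib]
    refine Finset.sum_congr rfl fun p _ => Finset.sum_congr rfl fun q _ => ?_
    ring
  rw [e3, e1]
  linear_combination 1 / 2 * e2

lemma lamb_eq_of_trace {R : Module.End ℝ (so n)} (hn : 3 ≤ n) {x : ℝ}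
    (h : (RicM R).trace = n * x) : lamb R = x := by
  have h3 : (n : ℝ) ≠ 0 := by positivity
  rw [lamb, h]; field_simp

lemma lamb_Qode_add_defect (hn : 3 ≤ n) (s : ℝ) {R : Module.End ℝ (so n)}
    (h : CurvLike (Rcoord R)) : lamb (Qode R + defect s R) = lamb R ^ 2
      + (1 + s) * (n - 1) * lamb R ^ 2 + sigmaR R * (n / 4)
      - sigmaR R * (s * n / (4 * (n + (n - 1) * s))) * (n - 1) := by
  refine lamb_eq_of_trace hn ?_
  rw [RicM_add, Matrix.trace_add, trace_RicM_Qode hn h, RicM_defect hn s h]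
  simp only [Matrix.trace_add, Matrix.trace_neg, Matrix.trace_smul, trace_Ric0 hn,
    trace_Ric0_sq hn, Matrix.trace_one, Fintype.card_fin, smul_eq_mul]
  ring

lemma Qode_lab (hn : 3 ≤ n) {s : ℝ} (hs : 0 ≤ s) {R : Module.End ℝ (so n)}
    (h : CurvLike (Rcoord R)) : Qode (lab ((1 + s) / 2) (1 / 2) R)
      = lab ((1 + s) / 2) (1 / 2) (Qode R + defect s R) := by
  have h3 : (3 : ℝ) ≤ n := by exact_mod_cast hn
  have hN : (n : ℝ) + (n - 1) * s ≠ 0 := by nlinarith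
  have hX := (curvLike_Qode h).add (curvLike_defect s h)
  have hH := labMat_symm ((1 + s) / 2) (1 / 2) h
  refine End_ext fun i j k l => ?_
  rw [Qode_apply (curvLike_lab _ _ h), Rcoord_lab hn _ _ hX]
  have e : Rcoord (lab ((1 + s) / 2) (1 / 2) R) = fun i j k l => Rcoord R i j k l
      + knn (labMat ((1 + s) / 2) (1 / 2) R) 1 i j k l := by
    ext i j k l; rw [Rcoord_lab hn _ _ h]
  rw [e, qb_add_knn h hH, Rcoord_add, Qode_apply h, Rcoord_defect s h]
  set H := labMat ((1 + s) / 2) (1 / 2) R with hHdef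
  set Λ := Ric0 R with hΛ
  set L := lamb R with hL
  set σ := sigmaR R with hσ
  have hP : ricT (Rcoord R) = Λ + L • 1 := RicM_split R
  have hH1 : H = (1 / 2 : ℝ) • Λ + ((1 + s) / 2 * L) • 1 := by rw [hHdef, labMat, add_comm]
  have hc : contrT (Rcoord R) H = (1 / 2 : ℝ) • RicM (Qode R) + (s / 2 * L) • (Λ + L • 1) := by
    have : H = (1 / 2 : ℝ) • RicM R + (s / 2 * L) • 1 := by
      rw [hH1, RicM_split R]; module
    rw [this, contrT_comb, contrT_one, hP, RicM_Qode h]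
  have htr : H.trace = (1 + s) / 2 * L * n := by
    rw [hH1]
    simp [Matrix.trace_add, Matrix.trace_smul, hΛ, trace_Ric0 hn]
  have hsq : H * H = (1 / 4 : ℝ) • (Λ * Λ) + ((1 + s) / 2 * L) • Λ
      + (((1 + s) / 2 * L) ^ 2) • (1 : Mat n) := by
    rw [hH1]
    simp only [add_mul, mul_add, smul_mul_assoc, mul_smul_comm, one_mul, mul_one]
    module
  have htr2 : (H * H).trace = 1 / 4 * (n * σ) + ((1 + s) / 2 * L) ^ 2 * n := by
    rw [hsq]
    simp [Matrix.trace_add, Matrix.trace_smul, hΛ, trace_Ric0 hn, trace_Ric0_sq hn, hσ]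
  have hX : labMat ((1 + s) / 2) (1 / 2) (Qode R + defect s R)
      = (1 / 2 : ℝ) • (RicM (Qode R) + RicM (defect s R))
        + (s / 2 * lamb (Qode R + defect s R)) • (1 : Mat n) := by
    rw [labMat, Ric0, RicM_add]; module
  rw [hX, lamb_Qode_add_defect hn s h, RicM_defect hn s h, hc, RicM_split R]
  have hricK (i j : Fin n) := ricT_knn (B := 1) hH i j
  have hconK (i j : Fin n) := contrT_knn hH i j
  simp only [mul_one, one_mul, Matrix.trace_one, Fintype.card_fin] at hricK
  simp only [knn, hP, hricK, hconK, htr, htr2]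
  simp only [hsq]
  rw [hH1]
  simp only [Matrix.add_apply, Matrix.smul_apply, smul_eq_mul, Matrix.neg_apply, ← hL, ← hσ, ← hΛ]
  obtain ⟨c, hc⟩ : ∃ c, c = s * n / (4 * ((n : ℝ) + (n - 1) * s)) := ⟨_, rfl⟩
  have hc' : 4 * (n + (n - 1) * s) * c = s * n := by rw [hc]; field_simp
  rw [← hc]
  linear_combination
    (σ / 4) * ((1 : Mat n) i k * (1 : Mat n) j l - (1 : Mat n) i l * (1 : Mat n) j k) * hc'

lemma ip_comm (A B : so n) : ip A B = ip B A := by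
  rw [ip, ip, Matrix.trace_mul_comm]

lemma gram_nonneg {α ι : Type*} [Fintype α] [Fintype ι] (v : ι → α → ℝ) (y : α → ℝ) :
    0 ≤ ∑ a, ∑ b, y a * y b * ∑ m, v m a * v m b := by
  have e : ∑ a, ∑ b, y a * y b * ∑ m, v m a * v m b = ∑ m, (∑ a, y a * v m a) ^ 2 := by
    simp only [sq, Finset.sum_mul_sum]
    simp only [Finset.mul_sum]
    rw [Finset.sum_comm (s := Finset.univ (α := ι))]
    refine Finset.sum_congr rfl fun a _ => ?_
    rw [Finset.sum_comm]
    exact Finset.sum_congr rfl fun m _ => Finset.sum_congr rfl fun b _ => by ring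
  rw [e]
  exact Finset.sum_nonneg fun m _ => sq_nonneg _

/-- A nonnegative curvature operator is a sum of squares. -/
lemma exists_gram {R : Module.End ℝ (so n)} (h : CurvLike (Rcoord R)) (hp : posSemidefEnd R) :
    ∃ (N : ℕ) (u : Fin N → Mat n), ∀ i j k l, Rcoord R i j k l = ∑ m, u m i j * u m k l := by
  set M : Matrix (Fin n × Fin n) (Fin n × Fin n) ℝ :=
    Matrix.of fun a b => Rcoord R a.1 a.2 b.1 b.2 with hM
  have hMp : M.PosSemidef := by
    refine Matrix.PosSemidef.of_dotProduct_mulVec_nonneg ?_ fun x => ?_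
    · ext a b
      simp [hM, h.symm a.1 a.2 b.1 b.2]
    · have e : star x ⬝ᵥ M *ᵥ x = ip (R (∑ p, x p • bvec p.1 p.2)) (∑ p, x p • bvec p.1 p.2) := by
        have e1 (Y : so n) : ip Y (∑ p, x p • bvec p.1 p.2) = ∑ p, x p * ip Y (bvec p.1 p.2) := by
          change ipL Y _ = _
          simp only [map_sum, map_smul, smul_eq_mul]; rfl
        rw [e1]
        simp only [dotProduct, Matrix.mulVec, star_trivial, hM, Matrix.of_apply, map_sum, map_smul]
        refine Finset.sum_congr rfl fun p _ => ?_
        congr 1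
        rw [ip_comm]
        change _ = ipL _ _
        simp only [map_sum, map_smul, smul_eq_mul]
        refine Finset.sum_congr rfl fun q _ => ?_
        rw [h.symm q.1 q.2, mul_comm]
        congr 1
        exact ip_comm _ _
      rw [e]; exact hp _
  obtain ⟨N, v, hv⟩ := Matrix.posSemidef_iff_eq_sum_vecMulVec.1 hMp
  refine ⟨N, fun m => Matrix.of fun i j => v m (i, j), fun i j k l => ?_⟩
  have := congrFun (congrFun hv (i, j)) (k, l)
  simpa [hM, Matrix.sum_apply, Matrix.vecMulVec_apply] using this

lemma Qode_nonneg {R : Module.End ℝ (so n)} (h : CurvLike (Rcoord R)) (hp : posSemidefEnd R) :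
    posSemidefEnd (Qode R) := by
  intro X
  obtain ⟨N, u, hu⟩ := exists_gram h hp
  have hX := so_skew X
  have g := gram_nonneg (fun (m : Fin N × Fin N) (a : Fin n × Fin n × Fin n) =>
    u m.1 a.1 a.2.2 * u m.2 a.2.1 a.2.2) (fun a => (X : Mat n) a.1 a.2.1)
  have hk (i j p k l q : Fin n) : ∑ m : Fin N × Fin N,
      u m.1 i p * u m.2 j p * (u m.1 k q * u m.2 l q) = Rcoord R i p k q * Rcoord R j p l q := by
    rw [hu, hu, Finset.sum_mul_sum, ← Finset.sum_product']
    exact Finset.sum_congr rfl fun m _ => by ring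
  have g2 := gram_nonneg (fun (m : Fin n × Fin n) (a : Fin n × Fin n) =>
    Rcoord R a.1 a.2 m.1 m.2) (fun a => (X : Mat n) a.1 a.2)
  simp only [hk, Fintype.sum_prod_type] at g g2
  have e1 : ∑ i, ∑ j, ∑ k, ∑ l, (X : Mat n) i j * (X : Mat n) k l *
      ∑ p, ∑ q, Rcoord R i p l q * Rcoord R j p k q = -∑ i, ∑ j, ∑ k, ∑ l,
      (X : Mat n) i j * (X : Mat n) k l * ∑ p, ∑ q, Rcoord R i p k q * Rcoord R j p l q := by
    simp only [← Finset.sum_neg_distrib]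
    refine Finset.sum_congr rfl fun i _ => Finset.sum_congr rfl fun j _ => ?_
    rw [Finset.sum_comm]
    refine Finset.sum_congr rfl fun k _ => Finset.sum_congr rfl fun l _ => ?_
    rw [hX k l]; ring
  have e2 : ∑ i, ∑ j, ∑ p, ∑ k, ∑ l, ∑ q, (X : Mat n) i j * (X : Mat n) k l *
      (Rcoord R i p k q * Rcoord R j p l q) = ∑ i, ∑ j, ∑ k, ∑ l,
      (X : Mat n) i j * (X : Mat n) k l * ∑ p, ∑ q, Rcoord R i p k q * Rcoord R j p l q := by
    simp only [Finset.mul_sum]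
    refine Finset.sum_congr rfl fun i _ => Finset.sum_congr rfl fun j _ => ?_
    rw [← sum_rotate]
  have e3 : ip (Qode R X) X = 1 / 8 * ∑ i, ∑ j, ∑ k, ∑ l, (X : Mat n) i j * (X : Mat n) k l *
      (∑ p, ∑ q, Rcoord R i j p q * Rcoord R k l p q)
      + 1 / 4 * ((∑ i, ∑ j, ∑ k, ∑ l, (X : Mat n) i j * (X : Mat n) k l *
      ∑ p, ∑ q, Rcoord R i p k q * Rcoord R j p l q) - ∑ i, ∑ j, ∑ k, ∑ l,
      (X : Mat n) i j * (X : Mat n) k l * ∑ p, ∑ q, Rcoord R i p l q * Rcoord R j p k q) := by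
    rw [ip_End]
    simp only [Finset.mul_sum, ← Finset.sum_add_distrib, ← Finset.sum_sub_distrib, Qode_apply h, qb]
    refine Finset.sum_congr rfl fun i _ => Finset.sum_congr rfl fun j _ =>
      Finset.sum_congr rfl fun k _ => Finset.sum_congr rfl fun l _ =>
      Finset.sum_congr rfl fun p _ => Finset.sum_congr rfl fun q _ => ?_
    rw [h.symm k l p q]; ring
  rw [e2] at g
  rw [e3, e1]
  linarith

lemma trace_RicM_gram {R : Module.End ℝ (so n)} {N : ℕ} {u : Fin N → Mat n}
    (hu : ∀ i j k l, Rcoord R i j k l = ∑ m, u m i j * u m k l) :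
    (RicM R).trace = ∑ i, ∑ j, ∑ m, u m i j ^ 2 := by
  simp only [Matrix.trace, Matrix.diag_apply, RicM, Matrix.of_apply, hu, sq]

lemma lamb_nonneg {R : Module.End ℝ (so n)} (h : CurvLike (Rcoord R))
    (hp : posSemidefEnd R) : 0 ≤ lamb R := by
  obtain ⟨N, u, hu⟩ := exists_gram h hp
  rw [lamb, trace_RicM_gram hu]
  positivity

lemma lamb_pos (hn : 3 ≤ n) {R : Module.End ℝ (so n)} (h : CurvLike (Rcoord R))
    (hp : posSemidefEnd R) (h0 : R ≠ 0) : 0 < lamb R := by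
  refine (lamb_nonneg h hp).lt_of_ne' fun hL => h0 ?_
  obtain ⟨N, u, hu⟩ := exists_gram h hp
  have ht := trace_RicM hn R
  rw [hL, mul_zero, trace_RicM_gram hu] at ht
  have hz (i j : Fin n) (m : Fin N) : u m i j = 0 := by
    have h1 := (Finset.sum_eq_zero_iff_of_nonneg fun i _ => by positivity).1 ht i (Finset.mem_univ _)
    have h2 := (Finset.sum_eq_zero_iff_of_nonneg fun i _ => by positivity).1 h1 j (Finset.mem_univ _)
    have h3 := (Finset.sum_eq_zero_iff_of_nonneg fun i _ => by positivity).1 h2 m (Finset.mem_univ _)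
    exact pow_eq_zero_iff (two_ne_zero) |>.1 h3
  refine End_ext fun i j k l => ?_
  rw [hu, Rcoord_eq]
  simp [hz]

lemma dot_mulVec_eq (A : Mat n) (v : Fin n → ℝ) :
    v ⬝ᵥ A *ᵥ v = ∑ i, ∑ j, v i * v j * A i j := by
  simp only [dotProduct, Matrix.mulVec, Finset.mul_sum]
  exact Finset.sum_congr rfl fun i _ => Finset.sum_congr rfl fun j _ => by ring

/-- A lower bound on the Ricci tensor of a nonnegative curvature operator propagates to
`R² + R^#`. -/
lemma ric_Qode_ge {R : Module.End ℝ (so n)} (h : CurvLike (Rcoord R)) (hp : posSemidefEnd R)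
    {c : ℝ} (hc : ∀ w : Fin n → ℝ, c * (w ⬝ᵥ w) ≤ w ⬝ᵥ RicM R *ᵥ w) (v : Fin n → ℝ) :
    c * (v ⬝ᵥ RicM R *ᵥ v) ≤ v ⬝ᵥ RicM (Qode R) *ᵥ v := by
  obtain ⟨N, u, hu⟩ := exists_gram h hp
  have hw (m : Fin N) := hc fun p => ∑ i, v i * u m i p
  have hq (p q : Fin n) : ∑ i, ∑ j, v i * v j * Rcoord R i p j q
      = ∑ m, (∑ i, v i * u m i p) * ∑ i, v i * u m i q := by
    simp only [Finset.sum_mul_sum, hu]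
    simp only [Finset.mul_sum]
    rw [sum_rotate]
    exact Finset.sum_congr rfl fun m _ => Finset.sum_congr rfl fun i _ =>
      Finset.sum_congr rfl fun j _ => by ring
  have e1 : v ⬝ᵥ RicM R *ᵥ v
      = ∑ m, (fun p => ∑ i, v i * u m i p) ⬝ᵥ (fun p => ∑ i, v i * u m i p) := by
    simp only [dot_mulVec_eq, RicM, Matrix.of_apply, Finset.mul_sum (s := Finset.univ)]
    simp only [dotProduct]
    rw [sum_rotate, Finset.sum_comm (s := Finset.univ (α := Fin N))]
    exact Finset.sum_congr rfl fun p _ => hq p p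
  have e2 : v ⬝ᵥ RicM (Qode R) *ᵥ v
      = ∑ m, (fun p => ∑ i, v i * u m i p) ⬝ᵥ RicM R *ᵥ (fun p => ∑ i, v i * u m i p) := by
    simp only [dot_mulVec_eq, RicM_Qode h, contrT, Matrix.of_apply]
    rw [← sum_rotate]
    simp only [← Finset.sum_mul, ← hq]
    simp only [Finset.mul_sum, Finset.sum_mul]
    rw [sum_comm_pairs fun p q i j => v i * v j * (Rcoord R i p j q * RicM R p q)]
    refine Finset.sum_congr rfl fun p _ => Finset.sum_congr rfl fun q _ =>
      Finset.sum_congr rfl fun i _ => Finset.sum_congr rfl fun j _ => by ring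
  rw [e1, e2, Finset.mul_sum]
  exact Finset.sum_le_sum fun m _ => hw m

lemma exists_diag {A : Mat n} (hA : ∀ i j, A j i = A i j) : ∃ (U : Mat n) (ev : Fin n → ℝ),
    Uᵀ * U = 1 ∧ U * Uᵀ = 1 ∧ A = U * Matrix.diagonal ev * Uᵀ := by
  have hH : A.IsHermitian := by
    ext i j; simp [hA]
  refine ⟨hH.eigenvectorUnitary, hH.eigenvalues, ?_, ?_, ?_⟩
  · have := Unitary.coe_star_mul_self hH.eigenvectorUnitary
    simpa [Matrix.star_eq_conjTranspose] using this
  · have := Unitary.coe_mul_star_self hH.eigenvectorUnitary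
    simpa [Matrix.star_eq_conjTranspose] using this
  · have := hH.spectral_theorem
    simpa [Matrix.star_eq_conjTranspose, Unitary.conjStarAlgAut_apply, Function.comp_def] using this

lemma excess_pos {n q m : ℝ} (hn : 3 ≤ n) (hq : 0 ≤ q) (hm : m * (n + 2 + q) = 4) :
    0 < 3 * m ^ 2 + (n - 6) * m + q * (1 - m) + n * m ^ 2 * (4 * n / (4 * n + (n - 1) * q)) := by
  obtain ⟨k, rfl⟩ : ∃ k, n = k + 3 := ⟨n - 3, by ring⟩
  have hk : 0 ≤ k := by linarith
  have hD : 0 < k + 3 + 2 + q := by linarith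
  have hE : 0 < 4 * (k + 3) + (k + 3 - 1) * q := by nlinarith
  have hm' : m = 4 / (k + 3 + 2 + q) := by field_simp; linarith
  have e : 3 * m ^ 2 + (k + 3 - 6) * m + q * (1 - m)
      + (k + 3) * m ^ 2 * (4 * (k + 3) / (4 * (k + 3) + (k + 3 - 1) * q))
      = ((48 + 4 * (k - 3) * (k + 5 + q) + q * (k + 1 + q) * (k + 5 + q))
          * (4 * (k + 3) + (k + 3 - 1) * q) + 64 * (k + 3) ^ 2)
        / ((k + 3 + 2 + q) ^ 2 * (4 * (k + 3) + (k + 3 - 1) * q)) := by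
    rw [hm']
    obtain ⟨W, hW⟩ : ∃ W, W = 4 * (k + 3) + (k + 3 - 1) * q := ⟨_, rfl⟩
    rw [← hW] at hE ⊢
    field_simp
    ring
  rw [e]
  refine div_pos ?_ (by positivity)
  have h0 : 0 < 432 - 108 * q + 58 * q ^ 2 := by nlinarith [sq_nonneg (q - 1)]
  have h1 : 0 ≤ k * q * 96 + k * q ^ 2 * 61 + k * q ^ 3 * 14 + k * q ^ 4 + k * 432
      + k ^ 2 * q * 68 + k ^ 2 * q ^ 2 * 20 + k ^ 2 * q ^ 3 * 2 + k ^ 2 * 144 + k ^ 3 * q * 8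
      + k ^ 3 * q ^ 2 + k ^ 3 * 16 + q ^ 3 * 24 + q ^ 4 * 2 := by positivity
  linarith

lemma defect_lower {n s m : ℝ} (hn : 3 ≤ n) (hs : 0 ≤ s) (hm : m * (n + 2 + 4 * s) = 4)
    {x y τ : ℝ} (hx : -m ≤ x) (hy : -m ≤ y) (hτ : τ ≤ (n - 1) * m ^ 2) :
    (3 * m ^ 2 + (n - 6) * m + 4 * s * (1 - m)
        + n * m ^ 2 * (4 * n / (4 * n + (n - 1) * (4 * s)))) / 4
      ≤ ((n - 2) / 4 - s) * (x * y) + (1 + s) * ((x + 1) * (y + 1)) + 1 / 4 * (x ^ 2 + y ^ 2)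
        - τ * (s * n / (4 * (n + (n - 1) * s))) := by
  have hE : 0 < n + (n - 1) * s := by nlinarith
  have hm1 : 0 < m := by
    by_contra hc; push Not at hc; nlinarith
  have h1 : τ * (s * n / (4 * (n + (n - 1) * s)))
      ≤ (n - 1) * m ^ 2 * (s * n / (4 * (n + (n - 1) * s))) := by gcongr
  have h2 : n * m ^ 2 * (4 * n / (4 * n + (n - 1) * (4 * s)))
      = n * m ^ 2 - 4 * ((n - 1) * m ^ 2 * (s * n / (4 * (n + (n - 1) * s)))) := by
    have : 4 * n + (n - 1) * (4 * s) ≠ 0 := by nlinarith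
    field_simp; ring
  rw [h2]
  have huv : 0 ≤ (x + m) * (y + m) := mul_nonneg (by linarith) (by linarith)
  have hlin : 0 ≤ s * (x + y + 2 * m) := mul_nonneg hs (by linarith)
  have hlin2 : 0 ≤ (1+m) * (s * (x + y + 2 * m)) := mul_nonneg (by linarith) hlin
  have h4 : m * n = 4 - 2 * m - 4 * s * m := by linarith
  nlinarith [sq_nonneg (x + y + m), mul_nonneg (by linarith : 0 ≤ n) huv]

lemma trace_conj {U : Mat n} (hU : Uᵀ * U = 1) (A : Mat n) : (U * A * Uᵀ).trace = A.trace := by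
  rw [Matrix.trace_mul_comm, ← Matrix.mul_assoc, hU, Matrix.one_mul]

lemma quad_diag (U : Mat n) (f v : Fin n → ℝ) :
    v ⬝ᵥ (U * Matrix.diagonal f * Uᵀ) *ᵥ v = ∑ i, f i * (Uᵀ *ᵥ v) i ^ 2 := by
  rw [← Matrix.mulVec_mulVec, ← Matrix.mulVec_mulVec, Matrix.dotProduct_mulVec,
    ← Matrix.mulVec_transpose]
  simp only [dotProduct, Matrix.mulVec_diagonal]
  exact Finset.sum_congr rfl fun i _ => by ring

lemma dot_self_rot {U : Mat n} (hU : U * Uᵀ = 1) (v : Fin n → ℝ) :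
    v ⬝ᵥ v = ∑ i, (Uᵀ *ᵥ v) i ^ 2 := by
  have := quad_diag U (fun _ => 1) v
  rw [Matrix.diagonal_one, Matrix.mul_one, hU, Matrix.one_mulVec] at this
  simpa using this

lemma ip_rot {U : Mat n} (hU : U * Uᵀ = 1) (A B : so n) : ip A B = 1 / 2 * ∑ i, ∑ j,
    (Uᵀ * (A : Mat n) * U) i j * (Uᵀ * (B : Mat n) * U) i j := by
  have e (C D : Mat n) : ∑ i, ∑ j, C i j * D i j = (C * Dᵀ).trace := by
    simp [Matrix.trace, Matrix.mul_apply]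
  rw [ip_eq, e, e]
  simp only [Matrix.transpose_mul, Matrix.transpose_transpose]
  congr 1
  calc _ = (Uᵀ * ((A : Mat n) * (B : Mat n)ᵀ) * (Uᵀ)ᵀ).trace := by
        rw [trace_conj]; simpa using hU
    _ = (Uᵀ * (A : Mat n) * (U * Uᵀ) * ((B : Mat n)ᵀ * U)).trace := by
        simp only [hU, Matrix.mul_one, Matrix.mul_assoc, Matrix.transpose_transpose]
    _ = _ := by simp only [Matrix.mul_assoc]

/-- The quadratic form of `defect s R` in an eigenbasis of `Ric0 R`. -/
lemma ip_defect (s : ℝ) {R : Module.End ℝ (so n)} {U : Mat n} {ev : Fin n → ℝ}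
    (hU : Uᵀ * U = 1) (hU' : U * Uᵀ = 1) (hΛ : Ric0 R = U * Matrix.diagonal ev * Uᵀ) (X : so n) :
    ip (defect s R X) X = 1 / 2 * ∑ i, ∑ j, ((((n : ℝ) - 2) / 4 - s) * (ev i * ev j)
      + (1 + s) * ((ev i + lamb R) * (ev j + lamb R)) + 1 / 4 * (ev i ^ 2 + ev j ^ 2)
      - sigmaR R * (s * n / (4 * (n + (n - 1) * s)))) * (Uᵀ * (X : Mat n) * U) i j ^ 2 := by
  set D := Matrix.diagonal ev with hD
  set Y := Uᵀ * (X : Mat n) * U with hY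
  have hX : (X : Mat n) = U * Y * Uᵀ := by
    calc (X : Mat n) = (U * Uᵀ) * (X : Mat n) * (U * Uᵀ) := by simp [hU']
      _ = _ := by rw [hY]; simp only [Matrix.mul_assoc]
  have hΛt : (Ric0 R)ᵀ = Ric0 R := by
    rw [hΛ, Matrix.transpose_mul, Matrix.transpose_mul, hD, Matrix.diagonal_transpose,
      Matrix.transpose_transpose, Matrix.mul_assoc]
  have cancel (A B : Mat n) : A * Uᵀ * (U * B) = A * B := by
    rw [Matrix.mul_assoc, ← Matrix.mul_assoc Uᵀ, hU, Matrix.one_mul]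
  have conj (A B : Mat n) : (U * A * Uᵀ) * (U * B * Uᵀ) = U * (A * B) * Uᵀ := by
    calc _ = (U * A * Uᵀ) * (U * (B * Uᵀ)) := by simp only [Matrix.mul_assoc]
      _ = _ := by rw [cancel]; simp only [Matrix.mul_assoc]
  have hP : RicM R = U * (D + lamb R • 1) * Uᵀ := by
    rw [RicM_split, hΛ]
    simp [Matrix.mul_add, Matrix.add_mul, hU']
  have hPt : (RicM R)ᵀ = RicM R := by
    rw [RicM_split, Matrix.transpose_add, hΛt, Matrix.transpose_smul, Matrix.transpose_one]
  have key : Uᵀ * ((defect s R X : so n) : Mat n) * U = (((n : ℝ) - 2) / 4 - s) • (D * Y * D)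
      + (1 + s) • ((D + lamb R • 1) * Y * (D + lamb R • 1)) + (1 / 4 : ℝ) • (D * D * Y + Y * (D * D))
      - (sigmaR R * (s * n / (4 * (n + (n - 1) * s)))) • Y := by
    have e : ((defect s R X : so n) : Mat n) = U * ((((n : ℝ) - 2) / 4 - s) • (D * Y * D)
      + (1 + s) • ((D + lamb R • 1) * Y * (D + lamb R • 1)) + (1 / 4 : ℝ) • (D * D * Y + Y * (D * D))
      - (sigmaR R * (s * n / (4 * (n + (n - 1) * s)))) • Y) * Uᵀ := by
      simp only [defect, LinearMap.add_apply, LinearMap.smul_apply, Submodule.coe_add,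
        Submodule.coe_smul, wedge_apply, hΛt, hPt, Matrix.transpose_mul, Matrix.transpose_one,
        Matrix.one_mul, Matrix.mul_one]
      rw [hP, hΛ, hX]
      simp only [conj, Matrix.mul_add, Matrix.add_mul, Matrix.mul_sub, Matrix.sub_mul,
        Matrix.mul_smul, Matrix.smul_mul]
      module
    rw [e]
    simp only [← Matrix.mul_assoc, hU, Matrix.one_mul]
    rw [Matrix.mul_assoc, hU, Matrix.mul_one]
  rw [ip_rot hU', key, ← hY]
  congr 1
  refine Finset.sum_congr rfl fun i _ => Finset.sum_congr rfl fun j _ => ?_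
  have hDL : D + lamb R • 1 = Matrix.diagonal fun i => ev i + lamb R := by
    rw [hD, ← Matrix.diagonal_one, ← Matrix.diagonal_smul, Matrix.diagonal_add]
    simp
  rw [hDL, hD]
  simp only [Matrix.add_apply, Matrix.sub_apply, Matrix.smul_apply, smul_eq_mul,
    Matrix.diagonal_mul_diagonal, Matrix.diagonal_mul, Matrix.mul_diagonal]
  ring

/-- Bounds on the eigenvalues of the traceless Ricci tensor of a pinched operator. -/
lemma eigenvalue_bounds (hn : 3 ≤ n) {R : Module.End ℝ (so n)} {p : ℝ} {U : Mat n}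
    {ev : Fin n → ℝ} (hU : Uᵀ * U = 1) (hU' : U * Uᵀ = 1)
    (hΛ : Ric0 R = U * Matrix.diagonal ev * Uᵀ)
    (hric : ∀ w : Fin n → ℝ, p * lamb R * (w ⬝ᵥ w) ≤ w ⬝ᵥ RicM R *ᵥ w) :
    ∑ i, ev i = 0 ∧ ∑ i, ev i ^ 2 = n * sigmaR R ∧ ∀ i, -((1 - p) * lamb R) ≤ ev i := by
  refine ⟨?_, ?_, fun i => ?_⟩
  · rw [← Matrix.trace_diagonal, ← trace_conj hU, ← hΛ, trace_Ric0 hn]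
  · have e : Matrix.diagonal (fun i => ev i ^ 2) = Matrix.diagonal ev * Matrix.diagonal ev := by
      rw [Matrix.diagonal_mul_diagonal]; simp only [sq]
    rw [← Matrix.trace_diagonal, e, ← trace_conj hU, ← trace_Ric0_sq hn, hΛ]
    congr 1
    calc _ = U * Matrix.diagonal ev * 1 * Matrix.diagonal ev * Uᵀ := by
          simp only [Matrix.mul_one, Matrix.mul_assoc]
      _ = _ := by rw [← hU]; simp only [Matrix.mul_assoc]
  · have h1 := hric (U *ᵥ Pi.single i 1)
    have e : Uᵀ *ᵥ (U *ᵥ Pi.single i 1) = (Pi.single i 1 : Fin n → ℝ) := by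
      rw [Matrix.mulVec_mulVec, hU, Matrix.one_mulVec]
    rw [RicM_split, Matrix.add_mulVec, dotProduct_add, hΛ, quad_diag, Matrix.smul_mulVec,
      dotProduct_smul, Matrix.one_mulVec, dot_self_rot hU', e] at h1
    simp [Pi.single_apply] at h1
    linarith

lemma ip_add_left (A B C : so n) : ip (A + B) C = ip A C + ip B C := by
  rw [ip_comm, ip_comm A, ip_comm B]; exact (ipL C).map_add A B

lemma ip_smul_left (c : ℝ) (A B : so n) : ip (c • A) B = c * ip A B := by
  rw [ip_comm, ip_comm A]; exact (ipL B).map_smul c A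

lemma lamb_add (R S : Module.End ℝ (so n)) : lamb (R + S) = lamb R + lamb S := by
  rw [lamb, RicM_add, Matrix.trace_add, add_div]; rfl

lemma lamb_smul (c : ℝ) (R : Module.End ℝ (so n)) : lamb (c • R) = c * lamb R := by
  rw [lamb, RicM_smul, Matrix.trace_smul, smul_eq_mul, mul_div_assoc]; rfl

lemma exists_ricci_lower (hn : 3 ≤ n) {s m L σ : ℝ} (hs : 0 ≤ s) (hm : 0 < m) (hm1 : m ≤ 1)
    (hL : 0 < L) {ev : Fin n → ℝ} (h0 : ∑ i, ev i = 0) (h2 : ∑ i, ev i ^ 2 = n * σ)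
    (hlow : ∀ i, -(m * L) ≤ ev i) : ∃ t > 0, ∃ δ > 0, ∀ i,
    δ ≤ (ev i + m * L) + t * (-ev i ^ 2 + ((1 + s) * (n - 2) + (1 - m)) * L * ev i
      + m * ((1 + s) * (n - 1) * L ^ 2 + σ * (n / 4)
        - σ * (s * n / (4 * (n + (n - 1) * s))) * (n - 1))) := by
  have hn' : (3 : ℝ) ≤ n := by exact_mod_cast hn
  have hE : 0 < (n : ℝ) + (n - 1) * s := by nlinarith
  set κ : ℝ := (n : ℝ) ^ 2 / (4 * (n + (n - 1) * s)) with hκ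
  have hκ0 : 0 < κ := by positivity
  have hκe : σ * (n / 4) - σ * (s * n / (4 * (n + (n - 1) * s))) * (n - 1) = σ * κ := by
    rw [hκ]
    obtain ⟨W, hW⟩ : ∃ W, W = (n : ℝ) + (n - 1) * s := ⟨_, rfl⟩
    rw [← hW] at hE ⊢
    field_simp
    rw [hW]; ring
  have hσ : 0 ≤ σ := by
    have : 0 ≤ ∑ i, ev i ^ 2 := Finset.sum_nonneg fun i _ => sq_nonneg _
    rw [h2] at this
    exact nonneg_of_mul_nonneg_right this (by linarith)
  have hmL : 0 < m * L := mul_pos hm hL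
  have hn0 : (0 : ℝ) < n := by linarith
  have hup (i : Fin n) : ev i + m * L ≤ n * (m * L) := by
    have h1 := Finset.single_le_sum (f := fun i => ev i + m * L)
      (fun i _ => by have := hlow i; linarith) (Finset.mem_univ i)
    simpa [Finset.sum_add_distrib, h0] using h1
  obtain ⟨t, ht⟩ : ∃ t, t = 1 / (2 * (n * (m * L))) := ⟨_, rfl⟩
  have ht0 : 0 < t := by rw [ht]; positivity
  have htn : t * (n * (m * L)) = 1 / 2 := by rw [ht]; field_simp
  have hF (i : Fin n) : (ev i + m * L) / 2 + t * (m * (σ * κ)) ≤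
      (ev i + m * L) + t * (-ev i ^ 2 + ((1 + s) * (n - 2) + (1 - m)) * L * ev i
      + m * ((1 + s) * (n - 1) * L ^ 2 + σ * (n / 4)
        - σ * (s * n / (4 * (n + (n - 1) * s))) * (n - 1))) := by
    have hy : 0 ≤ ev i + m * L := by linarith [hlow i]
    have e : -ev i ^ 2 + ((1 + s) * (n - 2) + (1 - m)) * L * ev i
      + m * ((1 + s) * (n - 1) * L ^ 2 + σ * (n / 4)
        - σ * (s * n / (4 * (n + (n - 1) * s))) * (n - 1))
      = m * (σ * κ) - (n * (m * L)) * (ev i + m * L) + (m * s * L ^ 2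
        + (n * (m * L) - (ev i + m * L)) * (ev i + m * L)
        + (2 * m + (1 + s) * (n - 2) + (1 - m)) * L * (ev i + m * L)) := by
      linear_combination m * hκe
    have hpos : 0 ≤ m * s * L ^ 2
        + (n * (m * L) - (ev i + m * L)) * (ev i + m * L)
        + (2 * m + (1 + s) * (n - 2) + (1 - m)) * L * (ev i + m * L) := by
      have a1 : 0 ≤ (n * (m * L) - (ev i + m * L)) * (ev i + m * L) :=
        mul_nonneg (by linarith [hup i]) hy
      have a2 : 0 ≤ (1 + s) * ((n : ℝ) - 2) := mul_nonneg (by linarith) (by linarith)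
      have a3 : 0 ≤ 2 * m + (1 + s) * ((n : ℝ) - 2) + (1 - m) := by linarith
      positivity
    rw [e]
    have := mul_nonneg ht0.le hpos
    linear_combination this + (ev i + m * L) * htn
  rcases hσ.eq_or_lt with h | h
  · refine ⟨t, ht0, m * L / 2, by positivity, fun i => le_trans ?_ (hF i)⟩
    have : ev i = 0 := by
      rw [← h, mul_zero] at h2
      exact pow_eq_zero_iff two_ne_zero |>.1
        ((Finset.sum_eq_zero_iff_of_nonneg fun i _ => sq_nonneg _).1 h2 i (Finset.mem_univ _))
    rw [this, ← h]; simp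
  · refine ⟨t, ht0, t * (m * (σ * κ)), by positivity, fun i => le_trans ?_ (hF i)⟩
    linarith [hlow i]

/-- Moving a nonzero pinched operator `R` in the direction `Q(R) + D(R)` makes all the
inequalities defining the pinching set strict. -/
lemma exists_strict (hn : 3 ≤ n) {s p : ℝ} (hs : 0 ≤ s) (hp : p = 1 - 4 / ((n : ℝ) + 2 + 4 * s))
    {R : Module.End ℝ (so n)} (h : CurvLike (Rcoord R)) (hR : posSemidefEnd R)
    (hric : ∀ w : Fin n → ℝ, p * lamb R * (w ⬝ᵥ w) ≤ w ⬝ᵥ RicM R *ᵥ w) (h0 : R ≠ 0) :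
    ∃ t : ℝ, 0 < t ∧ ∃ δ : ℝ, 0 < δ ∧
      (∀ X, δ * ip X X ≤ ip ((R + t • (Qode R + defect s R)) X) X) ∧
      ∀ v : Fin n → ℝ, δ * (v ⬝ᵥ v) ≤ v ⬝ᵥ RicM (R + t • (Qode R + defect s R)) *ᵥ v
        - p * lamb (R + t • (Qode R + defect s R)) * (v ⬝ᵥ v) := by
  have hn' : (3 : ℝ) ≤ n := by exact_mod_cast hn
  have hL := lamb_pos hn h hR h0
  obtain ⟨m, hm⟩ : ∃ m, m = 1 - p := ⟨_, rfl⟩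
  have hpm : p = 1 - m := by linarith
  have hm4 : m * (n + 2 + 4 * s) = 4 := by
    have : (n : ℝ) + 2 + 4 * s ≠ 0 := by linarith
    rw [hm, hp]; field_simp; ring
  have hm0 : 0 < m := by
    by_contra hc; push Not at hc; nlinarith
  have hm1 : m ≤ 1 := by
    by_contra hc; push Not at hc; nlinarith
  obtain ⟨U, ev, hU, hU', hΛ⟩ := exists_diag (Ric0_symm h)
  obtain ⟨hsum, hsq, hlow⟩ := eigenvalue_bounds hn hU hU' hΛ hric
  rw [← hm] at hlow
  obtain ⟨t, ht, δ₂, hδ₂, hF⟩ := exists_ricci_lower hn hs hm0 hm1 hL hsum hsq hlow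
  have hσ : sigmaR R / lamb R ^ 2 ≤ (n - 1) * m ^ 2 := by
    have h1 := Finset.sum_sq_le_sq_sum_of_nonneg (s := Finset.univ) (f := fun i => ev i + m * lamb R)
      (fun i _ => by linarith [hlow i])
    simp only [add_sq, Finset.sum_add_distrib, hsum, hsq, mul_assoc, ← Finset.mul_sum,
      ← Finset.sum_mul, Finset.sum_const, Finset.card_univ, Fintype.card_fin, nsmul_eq_mul] at h1
    rw [div_le_iff₀ (by positivity)]
    have h2 : (n : ℝ) * sigmaR R ≤ n * ((n - 1) * m ^ 2 * lamb R ^ 2) := by linarith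
    exact le_of_mul_le_mul_left h2 (by linarith)
  have hE := excess_pos hn' (mul_nonneg (by norm_num : (0 : ℝ) ≤ 4) hs) hm4
  set E := 3 * m ^ 2 + ((n : ℝ) - 6) * m + 4 * s * (1 - m)
        + n * m ^ 2 * (4 * n / (4 * n + (n - 1) * (4 * s))) with hEdef
  have hd (i j : Fin n) : E / 4 * lamb R ^ 2 ≤ (((n : ℝ) - 2) / 4 - s) * (ev i * ev j)
      + (1 + s) * ((ev i + lamb R) * (ev j + lamb R)) + 1 / 4 * (ev i ^ 2 + ev j ^ 2)
      - sigmaR R * (s * n / (4 * (n + (n - 1) * s))) := by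
    have hx (i : Fin n) : -m ≤ ev i / lamb R := by
      rw [le_div_iff₀ hL]; linarith [hlow i]
    have h1 := mul_le_mul_of_nonneg_right (defect_lower hn' hs hm4 (hx i) (hx j) hσ)
      (sq_nonneg (lamb R))
    refine h1.trans_eq ?_
    generalize s * n / (4 * (n + (n - 1) * s)) = c
    field_simp
  refine ⟨t, ht, min (t * (E / 4 * lamb R ^ 2)) δ₂, by positivity, fun X => ?_, fun v => ?_⟩
  · have hXX := ip_self_nonneg X
    have hD : E / 4 * lamb R ^ 2 * ip X X ≤ ip (defect s R X) X := by
      rw [ip_defect s hU hU' hΛ, ip_rot hU', mul_left_comm, Finset.mul_sum]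
      refine mul_le_mul_of_nonneg_left (Finset.sum_le_sum fun i _ => ?_) (by norm_num)
      rw [Finset.mul_sum]
      refine Finset.sum_le_sum fun j _ => ?_
      rw [← sq]
      exact mul_le_mul_of_nonneg_right (hd i j) (sq_nonneg _)
    have e : ip ((R + t • (Qode R + defect s R)) X) X
        = ip (R X) X + t * (ip (Qode R X) X + ip (defect s R X) X) := by
      simp only [LinearMap.add_apply, LinearMap.smul_apply, ip_add_left, ip_smul_left]
    rw [e]
    have h1 := mul_le_mul_of_nonneg_right (min_le_left (t * (E / 4 * lamb R ^ 2)) δ₂) hXX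
    have h2 := hR X
    have h3 := mul_nonneg ht.le (Qode_nonneg h hR X)
    have h4 := mul_le_mul_of_nonneg_left hD ht.le
    linarith
  · have hQ := mul_le_mul_of_nonneg_left (ric_Qode_ge h hR hric v) ht.le
    set w := Uᵀ *ᵥ v with hw
    have hvv := dot_self_rot hU' v
    have h1 : v ⬝ᵥ Ric0 R *ᵥ v = ∑ i, ev i * w i ^ 2 := by rw [hΛ, quad_diag]
    have h2 : v ⬝ᵥ (Ric0 R * Ric0 R) *ᵥ v = ∑ i, ev i ^ 2 * w i ^ 2 := by
      have e : Ric0 R * Ric0 R = U * Matrix.diagonal (fun i => ev i ^ 2) * Uᵀ := by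
        have e2 : Matrix.diagonal (fun i => ev i ^ 2) = Matrix.diagonal ev * Matrix.diagonal ev := by
          rw [Matrix.diagonal_mul_diagonal]; simp only [sq]
        calc Ric0 R * Ric0 R = U * Matrix.diagonal ev * (Uᵀ * U) * Matrix.diagonal ev * Uᵀ := by
              rw [hΛ]; simp only [Matrix.mul_assoc]
          _ = _ := by rw [hU, e2]; simp only [Matrix.mul_one, Matrix.mul_assoc]
      rw [e, quad_diag]
    have hP : v ⬝ᵥ RicM R *ᵥ v = ∑ i, (ev i + lamb R) * w i ^ 2 := by
      rw [RicM_split, Matrix.add_mulVec, dotProduct_add, h1, Matrix.smul_mulVec, dotProduct_smul,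
        Matrix.one_mulVec, hvv, smul_eq_mul, Finset.mul_sum, ← Finset.sum_add_distrib]
      exact Finset.sum_congr rfl fun i _ => by ring
    have hDf : v ⬝ᵥ RicM (defect s R) *ᵥ v = ∑ i, (-ev i ^ 2 + (1 + s) * (n - 2) * lamb R * ev i
        + ((1 + s) * (n - 1) * lamb R ^ 2 + sigmaR R * (n / 4)
        - sigmaR R * (s * n / (4 * (n + (n - 1) * s))) * (n - 1))) * w i ^ 2 := by
      rw [RicM_defect hn s h]
      simp only [Matrix.add_mulVec, dotProduct_add, Matrix.neg_mulVec, dotProduct_neg, h1, h2,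
        Matrix.smul_mulVec, dotProduct_smul, Matrix.one_mulVec, hvv, smul_eq_mul, Finset.mul_sum,
        ← Finset.sum_add_distrib, ← Finset.sum_neg_distrib]
      exact Finset.sum_congr rfl fun i _ => by ring
    have e : v ⬝ᵥ RicM (R + t • (Qode R + defect s R)) *ᵥ v
        = v ⬝ᵥ RicM R *ᵥ v + t * (v ⬝ᵥ RicM (Qode R) *ᵥ v + v ⬝ᵥ RicM (defect s R) *ᵥ v) := by
      simp only [RicM_add, RicM_smul, Matrix.add_mulVec, Matrix.smul_mulVec, dotProduct_add,
        dotProduct_smul, smul_eq_mul]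
    have hmin : min (t * (E / 4 * lamb R ^ 2)) δ₂ * (v ⬝ᵥ v) ≤ ∑ i, δ₂ * w i ^ 2 := by
      rw [hvv, ← Finset.mul_sum]
      exact mul_le_mul_of_nonneg_right (min_le_right _ _)
        (Finset.sum_nonneg fun i _ => sq_nonneg _)
    have hFs := Finset.sum_le_sum fun i (_ : i ∈ Finset.univ) =>
      mul_le_mul_of_nonneg_right (hF i) (sq_nonneg (w i))
    refine (hmin.trans hFs).trans ?_
    rw [e, lamb_add, lamb_smul, lamb_Qode_add_defect hn s h]
    have e2 : ∑ i, (ev i + m * lamb R + t * (-ev i ^ 2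
          + ((1 + s) * (n - 2) + (1 - m)) * lamb R * ev i
          + m * ((1 + s) * (n - 1) * lamb R ^ 2 + sigmaR R * (n / 4)
            - sigmaR R * (s * n / (4 * (n + (n - 1) * s))) * (n - 1)))) * w i ^ 2
        = v ⬝ᵥ RicM R *ᵥ v + (t * (p * lamb R * (v ⬝ᵥ RicM R *ᵥ v))
          + t * (v ⬝ᵥ RicM (defect s R) *ᵥ v))
          - p * (lamb R + t * (lamb R ^ 2 + (1 + s) * (n - 1) * lamb R ^ 2 + sigmaR R * (n / 4)
            - sigmaR R * (s * n / (4 * (n + (n - 1) * s))) * (n - 1))) * (v ⬝ᵥ v) := by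
      rw [hP, hDf, hvv]
      simp only [Finset.mul_sum, ← Finset.sum_add_distrib, ← Finset.sum_sub_distrib]
      refine Finset.sum_congr rfl fun i _ => ?_
      rw [hpm]; ring
    rw [e2, mul_add t]
    linarith

lemma mem_Cpinch_iff {p : ℝ} {R : Module.End ℝ (so n)} : R ∈ Cpinch n p ↔
    CurvLike (Rcoord R) ∧ posSemidefEnd R ∧
      ∀ w : Fin n → ℝ, p * lamb R * (w ⬝ᵥ w) ≤ w ⬝ᵥ RicM R *ᵥ w := by
  have e (w : Fin n → ℝ) : star w ⬝ᵥ (RicM R - (p * lamb R) • (1 : Mat n)) *ᵥ w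
      = w ⬝ᵥ RicM R *ᵥ w - p * lamb R * (w ⬝ᵥ w) := by
    rw [star_trivial, Matrix.sub_mulVec, dotProduct_sub, Matrix.smul_mulVec, dotProduct_smul,
      Matrix.one_mulVec, smul_eq_mul]
  constructor
  · rintro ⟨h1, h2, h3⟩
    refine ⟨h1.curvLike, h2, fun w => ?_⟩
    have := h3.dotProduct_mulVec_nonneg w
    rw [← lamb, e] at this
    linarith
  · rintro ⟨h1, h2, h3⟩
    refine ⟨h1.isCurvOp, h2, Matrix.PosSemidef.of_dotProduct_mulVec_nonneg ?_ fun w => ?_⟩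
    · ext i j
      simp [RicM_symm h1 i j, Matrix.one_apply, eq_comm]
    · rw [← lamb, e]
      linarith [h3 w]

lemma sum_abs_mul_le {α : Type*} [Fintype α] {M : α → α → ℝ} {η : ℝ}
    (hM : ∀ a b, |M a b| ≤ η) (v : α → ℝ) :
    |∑ a, ∑ b, v a * v b * M a b| ≤ η * (Fintype.card α * ∑ a, v a ^ 2) := by
  rcases isEmpty_or_nonempty α with hα | ⟨⟨a₀⟩⟩
  · simp
  have hη : 0 ≤ η := (abs_nonneg _).trans (hM a₀ a₀)
  calc |∑ a, ∑ b, v a * v b * M a b| ≤ ∑ a, ∑ b, |v a| * |v b| * η := by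
        refine (Finset.abs_sum_le_sum_abs _ _).trans (Finset.sum_le_sum fun a _ => ?_)
        refine (Finset.abs_sum_le_sum_abs _ _).trans (Finset.sum_le_sum fun b _ => ?_)
        rw [abs_mul, abs_mul]
        exact mul_le_mul_of_nonneg_left (hM a b) (by positivity)
    _ = η * (∑ a, |v a|) ^ 2 := by
        simp only [← Finset.sum_mul, ← Finset.mul_sum, sq]; ring
    _ ≤ η * (Fintype.card α * ∑ a, v a ^ 2) := by
        have := sq_sum_le_card_mul_sum_sq (s := Finset.univ) (f := fun a => |v a|)
        simp only [sq_abs, Finset.card_univ] at this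
        exact mul_le_mul_of_nonneg_left this hη

lemma abs_RicM_le {E : Module.End ℝ (so n)} {η : ℝ} (hE : ∀ i j k l, |Rcoord E i j k l| ≤ η)
    (i j : Fin n) : |RicM E i j| ≤ n * η := by
  simp only [RicM, Matrix.of_apply]
  refine (Finset.abs_sum_le_sum_abs _ _).trans ?_
  refine (Finset.sum_le_sum fun k _ => hE i k j k).trans ?_
  simp

lemma abs_lamb_le (hn : 3 ≤ n) {E : Module.End ℝ (so n)} {η : ℝ}
    (hE : ∀ i j k l, |Rcoord E i j k l| ≤ η) : |lamb E| ≤ n * η := by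
  have hn0 : (0 : ℝ) < n := by positivity
  rw [lamb, abs_div, abs_of_pos hn0, div_le_iff₀ hn0, Matrix.trace]
  refine (Finset.abs_sum_le_sum_abs _ _).trans ?_
  refine (Finset.sum_le_sum fun k _ => abs_RicM_le hE k k).trans ?_
  simp; linarith

lemma abs_ip_le {E : Module.End ℝ (so n)} {η : ℝ} (hE : ∀ i j k l, |Rcoord E i j k l| ≤ η)
    (X : so n) : |ip (E X) X| ≤ η * n ^ 2 * ip X X := by
  have h := sum_abs_mul_le (fun (a b : Fin n × Fin n) => hE a.1 a.2 b.1 b.2)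
    (fun a => (X : Mat n) a.1 a.2)
  simp only [Fintype.sum_prod_type, Fintype.card_prod, Fintype.card_fin, Nat.cast_mul] at h
  have h0 : 0 ≤ ∑ i, ∑ j, (X : Mat n) i j ^ 2 := by positivity
  rw [ip_End, ip_eq, abs_mul, abs_of_pos (by norm_num : (0 : ℝ) < 1 / 4)]
  simp only [← sq]
  linarith [abs_nonneg (∑ i, ∑ j, ∑ k, ∑ l, (X : Mat n) i j * (X : Mat n) k l * Rcoord E i j k l)]

/-- Operators strictly inside the pinching set stay in it under small perturbations. -/
lemma mem_Cpinch_of_strict (hn : 3 ≤ n) {p δ η : ℝ} (hp : |p| ≤ 1) {R E : Module.End ℝ (so n)}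
    (hR : CurvLike (Rcoord R)) (hE : CurvLike (Rcoord E)) (h1 : ∀ X, δ * ip X X ≤ ip (R X) X)
    (h2 : ∀ v : Fin n → ℝ, δ * (v ⬝ᵥ v) ≤ v ⬝ᵥ RicM R *ᵥ v - p * lamb R * (v ⬝ᵥ v))
    (hη : ∀ i j k l, |Rcoord E i j k l| ≤ η) (hηδ : η * (n ^ 2 + n) ≤ δ) :
    R + E ∈ Cpinch n p := by
  have hn' : (3 : ℝ) ≤ n := by exact_mod_cast hn
  have hη0 : 0 ≤ η := by
    have i : Fin n := ⟨0, by omega⟩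
    exact (abs_nonneg _).trans (hη i i i i)
  refine mem_Cpinch_iff.2 ⟨hR.add hE, fun X => ?_, fun v => ?_⟩
  · rw [LinearMap.add_apply, ip_add_left]
    have h3 := (abs_le.1 (abs_ip_le hη X)).1
    have hXX := ip_self_nonneg X
    have h4 := mul_le_mul_of_nonneg_right hηδ hXX
    have h5 : 0 ≤ η * n * ip X X := by positivity
    linarith [h1 X]
  · have hvv : 0 ≤ v ⬝ᵥ v := Finset.sum_nonneg fun i _ => mul_self_nonneg _
    have h3 := (abs_le.1 (sum_abs_mul_le (abs_RicM_le hη) v)).1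
    rw [← dot_mulVec_eq, Fintype.card_fin] at h3
    have e : ∑ a, v a ^ 2 = v ⬝ᵥ v := by simp only [dotProduct, sq]
    rw [e] at h3
    have h4 : p * lamb E ≤ n * η := by
      refine (le_abs_self _).trans ?_
      rw [abs_mul]
      calc |p| * |lamb E| ≤ 1 * (n * η) :=
            mul_le_mul hp (abs_lamb_le hn hη) (abs_nonneg _) (by norm_num)
        _ = n * η := one_mul _
    have h5 := mul_le_mul_of_nonneg_right h4 hvv
    have h6 := mul_le_mul_of_nonneg_right hηδ hvv
    rw [RicM_add, lamb_add, Matrix.add_mulVec, dotProduct_add]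
    linarith [h2 v]

lemma sq_le_ip (A : so n) (k l : Fin n) : (A : Mat n) k l ^ 2 ≤ 2 * ip A A := by
  have key (M : Mat n) : M k l ^ 2 ≤ ∑ i, ∑ j, M i j ^ 2 := by
    have h1 : M k l ^ 2 ≤ ∑ j, M k j ^ 2 :=
      Finset.single_le_sum (f := fun j => M k j ^ 2) (fun j _ => sq_nonneg _) (Finset.mem_univ l)
    refine h1.trans ?_
    exact Finset.single_le_sum (f := fun i => ∑ j, M i j ^ 2)
      (fun i _ => Finset.sum_nonneg fun j _ => sq_nonneg _) (Finset.mem_univ k)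
  rw [ip_eq]
  simp only [← sq]
  linarith [key A]

lemma ip_apply_bvec_le (E : Module.End ℝ (so n)) {i j : Fin n} (hij : i < j) :
    ip (E (bvec i j)) (E (bvec i j)) ≤ endNorm E ^ 2 := by
  rw [endNorm, Real.sq_sqrt (Finset.sum_nonneg fun p _ => ip_self_nonneg _)]
  have hmem : (i, j) ∈ pairs n := by simpa [pairs] using hij
  generalize hg : (fun p : Fin n × Fin n => ip (E (bvec p.1 p.2)) (E (bvec p.1 p.2))) = g
  have hg0 : ∀ p ∈ pairs n, 0 ≤ g p := fun p _ => by rw [← hg]; exact ip_self_nonneg _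
  have e : ip (E (bvec i j)) (E (bvec i j)) = g (i, j) := by rw [← hg]
  rw [e]
  exact Finset.single_le_sum hg0 hmem

lemma abs_Rcoord_le (E : Module.End ℝ (so n)) (i j k l : Fin n) :
    |Rcoord E i j k l| ≤ 2 * endNorm E := by
  have h0 : 0 ≤ endNorm E := Real.sqrt_nonneg _
  have key (i j : Fin n) (hij : i < j) : |Rcoord E i j k l| ≤ 2 * endNorm E := by
    have h1 : (Rcoord E i j k l) ^ 2 ≤ 2 * ip (E (bvec i j)) (E (bvec i j)) := by
      rw [Rcoord_eq]; exact sq_le_ip _ k l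
    have h2 := ip_apply_bvec_le E hij
    refine abs_le_of_sq_le_sq ?_ (by linarith)
    rw [mul_pow]
    linarith [sq_nonneg (endNorm E)]
  rcases lt_trichotomy i j with h | h | h
  · exact key i j h
  · rw [h, Rcoord_eq, bvec_self, map_zero]
    simpa using h0
  · rw [Rcoord_skew_left, abs_neg]; exact key j i h

lemma labMat_lab (hn : 3 ≤ n) (a b a' b' : ℝ) {R : Module.End ℝ (so n)}
    (h : CurvLike (Rcoord R)) : labMat a b (lab a' b' R)
      = labMat (a * (1 + 2 * (n - 1) * a')) (b * (1 + (n - 2) * b')) R := by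
  have hric : RicM (lab a' b' R) = (1 + (n - 2) * b') • Ric0 R
      + ((1 + 2 * (n - 1) * a') * lamb R) • (1 : Mat n) := by
    ext i j
    have e : Rcoord (lab a' b' R) = fun i j k l => Rcoord R i j k l
        + knn (labMat a' b' R) 1 i j k l := by
      ext i j k l; rw [Rcoord_lab hn _ _ h]
    rw [RicM_eq, e, ricT_add, ← RicM_eq, RicM_split, ricT_knn (labMat_symm _ _ h)]
    simp only [labMat, Matrix.trace_add, Matrix.trace_smul, Matrix.trace_one, trace_Ric0 hn,
      Fintype.card_fin, Matrix.add_apply, Matrix.smul_apply, smul_eq_mul, Matrix.mul_one,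
      Matrix.one_mul]
    ring
  have hl : lamb (lab a' b' R) = (1 + 2 * (n - 1) * a') * lamb R := by
    refine lamb_eq_of_trace hn ?_
    rw [hric, Matrix.trace_add, Matrix.trace_smul, Matrix.trace_smul, trace_Ric0 hn,
      Matrix.trace_one, Fintype.card_fin, smul_eq_mul, smul_eq_mul]
    ring
  rw [labMat, labMat, Ric0, hl, hric]
  module

/-- The maps `ℓ_{a,b}` invert each other for suitable parameters. -/
lemma lab_lab (hn : 3 ≤ n) {a b a' b' : ℝ} (ha : a' + a * (1 + 2 * (n - 1) * a') = 0)
    (hb : b' + b * (1 + (n - 2) * b') = 0) {R : Module.End ℝ (so n)}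
    (h : CurvLike (Rcoord R)) : lab a b (lab a' b' R) = R := by
  refine End_ext fun i j k l => ?_
  rw [Rcoord_lab hn _ _ (curvLike_lab _ _ h), Rcoord_lab hn _ _ h, labMat_lab hn _ _ _ _ h]
  have e : labMat a' b' R = -labMat (a * (1 + 2 * (n - 1) * a')) (b * (1 + (n - 2) * b')) R := by
    ext i j
    simp only [labMat, Matrix.add_apply, Matrix.smul_apply, Matrix.neg_apply, smul_eq_mul]
    linear_combination (lamb R * (1 : Mat n) i j) * ha + Ric0 R i j * hb
  rw [e]
  simp only [knn, Matrix.neg_apply]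
  ring

lemma labMat_add_smul (a b t : ℝ) (R S : Module.End ℝ (so n)) :
    labMat a b (R + t • S) = labMat a b R + t • labMat a b S := by
  simp only [labMat, Ric0, lamb_add, lamb_smul, RicM_add, RicM_smul]
  module

lemma lab_add_smul (hn : 3 ≤ n) (a b t : ℝ) {R S : Module.End ℝ (so n)}
    (hR : CurvLike (Rcoord R)) (hS : CurvLike (Rcoord S)) :
    lab a b (R + t • S) = lab a b R + t • lab a b S := by
  refine End_ext fun i j k l => ?_
  rw [Rcoord_lab hn _ _ (hR.add (hS.smul t))]
  simp only [Rcoord_add, Rcoord_smul, Rcoord_lab hn _ _ hR, Rcoord_lab hn _ _ hS,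
    labMat_add_smul, knn, Matrix.add_apply, Matrix.smul_apply, smul_eq_mul]
  ring

lemma abs_Rcoord_lab_le (hn : 3 ≤ n) (a b : ℝ) {E : Module.End ℝ (so n)}
    (h : CurvLike (Rcoord E)) {η : ℝ} (hE : ∀ i j k l, |Rcoord E i j k l| ≤ η) (i j k l : Fin n) :
    |Rcoord (lab a b E) i j k l| ≤ (1 + 4 * (n * (|a| + 2 * |b|))) * η := by
  have hη : 0 ≤ η := (abs_nonneg _).trans (hE i j k l)
  have hone (i j : Fin n) : |(1 : Mat n) i j| ≤ 1 := by
    rw [Matrix.one_apply]; split_ifs <;> simp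
  have hl := abs_lamb_le hn hE
  have hM (i j : Fin n) : |labMat a b E i j| ≤ n * (|a| + 2 * |b|) * η := by
    have e : labMat a b E i j = (a - b) * lamb E * (1 : Mat n) i j + b * RicM E i j := by
      simp only [labMat, Ric0, Matrix.add_apply, Matrix.smul_apply, Matrix.sub_apply, smul_eq_mul]
      ring
    have h1 : |lamb E * (1 : Mat n) i j| ≤ n * η := by
      rw [abs_mul]
      calc _ ≤ n * η * 1 := mul_le_mul hl (hone i j) (abs_nonneg _) (by positivity)
        _ = _ := mul_one _
    rw [e, mul_assoc]
    refine (abs_add_le _ _).trans ?_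
    rw [abs_mul, abs_mul b]
    have h2 := mul_le_mul (abs_sub a b) h1 (abs_nonneg _) (by positivity)
    have h3 := mul_le_mul_of_nonneg_left (abs_RicM_le hE i j) (abs_nonneg b)
    linarith
  have hprod (i j k l : Fin n) : |labMat a b E i j * (1 : Mat n) k l|
      ≤ n * (|a| + 2 * |b|) * η := by
    rw [abs_mul]
    calc _ ≤ n * (|a| + 2 * |b|) * η * 1 :=
          mul_le_mul (hM i j) (hone k l) (abs_nonneg _) (by positivity)
      _ = _ := mul_one _
  rw [Rcoord_lab hn _ _ h, knn, abs_le]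
  have g0 := abs_le.1 (hE i j k l)
  have g1 := abs_le.1 (hprod i k j l)
  have g2 := abs_le.1 (hprod j l i k)
  have g3 := abs_le.1 (hprod i l j k)
  have g4 := abs_le.1 (hprod j k i l)
  constructor <;> linarith [g0.1, g0.2, g1.1, g1.2, g2.1, g2.2, g3.1, g3.2, g4.1, g4.2]

lemma endNorm_zero : endNorm (0 : Module.End ℝ (so n)) = 0 := by
  simp [endNorm, ip]

lemma lab_zero (a b : ℝ) : lab a b (0 : Module.End ℝ (so n)) = 0 := by
  have h0 (i j k l : Fin n) : Rcoord (0 : Module.End ℝ (so n)) i j k l = 0 := by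
    simp [Rcoord, ip]
  have h1 : RicM (0 : Module.End ℝ (so n)) = 0 := by
    ext i j; simp [RicM, h0]
  have h2 : lamb (0 : Module.End ℝ (so n)) = 0 := by simp [lamb, h1]
  have h3 : Ric0 (0 : Module.End ℝ (so n)) = 0 := by simp [Ric0, h1, h2]
  have h4 : wedge (0 : Mat n) 1 = 0 := by
    ext X : 2
    simp [wedge, wedgeAux]
  simp [lab, RI, RRic0, h2, h3, h4]

lemma Qode_zero : Qode (0 : Module.End ℝ (so n)) = 0 := by
  have h1 (B : so n) : brk (0 : so n) B = 0 := by
    ext1; simp [brk]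
  have h2 : ipL (0 : so n) = 0 := by
    ext B; simp [ipL, ip]
  simp only [Qode, sharp, LinearMap.zero_apply, h1, h2, LinearMap.smulRight_zero,
    LinearMap.zero_smulRight, add_zero, Finset.sum_const_zero, smul_zero, mul_zero]

lemma mem_tangCone_of_add_smul_mem {C : Set (Module.End ℝ (so n))} {S Y : Module.End ℝ (so n)}
    {t : ℝ} (ht : 0 < t) (h : S + t • Y ∈ C) : Y ∈ tangCone C S := by
  refine fun ε hε => ⟨_, h, t⁻¹, by positivity, ?_⟩
  have e : Y - t⁻¹ • (S + t • Y - S) = 0 := by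
    ext1 X
    simp [smul_smul, inv_mul_cancel₀ ht.ne']
  rw [e, endNorm_zero]
  exact hε

lemma mem_of_mem_interiorCurv {C : Set (Module.End ℝ (so n))} {X : Module.End ℝ (so n)}
    (h : X ∈ interiorCurv C) : X ∈ C := by
  obtain ⟨h1, ε, hε, h2⟩ := h
  have e : X - X = 0 := sub_self X
  exact h2 X h1 (by rwa [e, endNorm_zero])

lemma exists_lab_inverse_param {a c : ℝ} (ha : 0 < a) (hc : 0 < c) :
    ∃ x : ℝ, x + a * (1 + c * x) = 0 := by
  have hd : 1 + c * a ≠ 0 := by positivity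
  refine ⟨-a / (1 + c * a), ?_⟩
  field_simp
  ring

/-- The ODE vector field points strictly into the image of the pinching set away from `0`. -/
lemma Qode_lab_mem_interior (hn : 3 ≤ n) {s p : ℝ} (hs : 0 ≤ s)
    (hp : p = 1 - 4 / ((n : ℝ) + 2 + 4 * s)) {R : Module.End ℝ (so n)} (hR : R ∈ Cpinch n p)
    (h0 : R ≠ 0) : Qode (lab ((1 + s) / 2) (1 / 2) R) ∈ interiorCurv
      (tangCone (lab ((1 + s) / 2) (1 / 2) '' Cpinch n p) (lab ((1 + s) / 2) (1 / 2) R)) := by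
  have hn' : (3 : ℝ) ≤ n := by exact_mod_cast hn
  have hp1 : |p| ≤ 1 := by
    have h4 : 4 / ((n : ℝ) + 2 + 4 * s) ≤ 1 := by
      rw [div_le_one (by positivity)]; linarith
    have h5 : 0 ≤ 4 / ((n : ℝ) + 2 + 4 * s) := by positivity
    rw [abs_le]; constructor <;> linarith
  obtain ⟨h, hpos, hric⟩ := mem_Cpinch_iff.1 hR
  obtain ⟨t, ht, δ, hδ, hX1, hX2⟩ := exists_strict hn hs hp h hpos hric h0
  set a : ℝ := (1 + s) / 2 with ha
  set b : ℝ := 1 / 2 with hb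
  have hQS : CurvLike (Rcoord (Qode (lab a b R))) := curvLike_Qode (curvLike_lab _ _ h)
  have hX : CurvLike (Rcoord (Qode R + defect s R)) :=
    (curvLike_Qode h).add (curvLike_defect s h)
  obtain ⟨a', ha'⟩ : ∃ a' : ℝ, a' + a * (1 + 2 * (n - 1) * a') = 0 :=
    exists_lab_inverse_param (by positivity) (by linarith)
  obtain ⟨b', hb'⟩ : ∃ b' : ℝ, b' + b * (1 + (n - 2) * b') = 0 :=
    exists_lab_inverse_param (by positivity) (by linarith)
  set c : ℝ := t * ((1 + 4 * (n * (|a'| + 2 * |b'|))) * 2) * (n ^ 2 + n) with hc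
  have hc0 : 0 < c := by positivity
  refine ⟨hQS.isCurvOp, δ / c, by positivity, fun Y hY hYn => ?_⟩
  refine mem_tangCone_of_add_smul_mem ht ?_
  set E := Y - Qode (lab a b R) with hE
  have hEc : CurvLike (Rcoord E) := by
    have e : E = Y + (-1 : ℝ) • Qode (lab a b R) := by rw [hE]; module
    rw [e]; exact hY.curvLike.add (hQS.smul _)
  have hF : CurvLike (Rcoord (lab a' b' E)) := curvLike_lab _ _ hEc
  refine ⟨R + t • (Qode R + defect s R) + t • lab a' b' E, ?_, ?_⟩
  · refine mem_Cpinch_of_strict hn hp1 (h.add (hX.smul t)) (hF.smul t) hX1 hX2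
      (η := t * ((1 + 4 * (n * (|a'| + 2 * |b'|))) * (2 * endNorm E))) (fun i j k l => ?_) ?_
    · rw [Rcoord_smul, abs_mul, abs_of_pos ht]
      exact mul_le_mul_of_nonneg_left
        (abs_Rcoord_lab_le hn a' b' hEc (abs_Rcoord_le E) i j k l) ht.le
    · have := (lt_div_iff₀ hc0).1 hYn
      rw [hc] at this
      linarith
  · rw [lab_add_smul hn a b t (h.add (hX.smul t)) hF, lab_add_smul hn a b t h hX,
      lab_lab hn ha' hb' hEc, ← Qode_lab hn hs h, hE]
    module

/-- Lemma (second family): for `b = 1/2`, `a = (1+s)/2`, `p = 1 − 4/(n+2+4s)`, the set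
`ℓ_{a,b}(C(p))` is invariant under the ODE `dR/dt = R² + R^#`, and transverse to the
boundary at nonzero boundary points. -/
theorem stmt_16 {n : ℕ} (hn : 3 ≤ n) (s : ℝ) (hs : 0 ≤ s) (b a p : ℝ)
    (hb : b = 1 / 2) (ha : a = (1 + s) / 2) (hp : p = 1 - 4 / ((n : ℝ) + 2 + 4 * s)) :
    (∀ S ∈ lab a b '' Cpinch n p, Qode S ∈ tangCone (lab a b '' Cpinch n p) S) ∧
      ∀ S ∈ lab a b '' Cpinch n p, S ≠ 0 →
        Qode S ∈ interiorCurv (tangCone (lab a b '' Cpinch n p) S) := by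
  subst hb ha
  have key : ∀ R ∈ Cpinch n p, R ≠ 0 → Qode (lab ((1 + s) / 2) (1 / 2) R) ∈ interiorCurv
      (tangCone (lab ((1 + s) / 2) (1 / 2) '' Cpinch n p) (lab ((1 + s) / 2) (1 / 2) R)) :=
    fun R hR h0 => Qode_lab_mem_interior hn hs hp hR h0
  constructor
  · rintro _ ⟨R, hR, rfl⟩
    by_cases h0 : R = 0
    · subst h0
      refine mem_tangCone_of_add_smul_mem one_pos ⟨0, hR, ?_⟩
      rw [lab_zero, Qode_zero, smul_zero, add_zero]
    · exact mem_of_mem_interiorCurv (key R hR h0)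
  · rintro _ ⟨R, hR, rfl⟩ hS
    refine key R hR ?_
    rintro rfl
    exact hS (lab_zero _ _)

end BW
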